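/- arXiv:1603.02321 — 4 statements merged into one kernel-verified Lean document; each statement's English description precedes it below -/
import Mathlib

section
/- Let (X,d) be a finite metric space, let K ⊆ X be a nonempty set of terminals, let p ≥ 1 be a real number, let α ≥ 1 be a real number, and let m be a natural number. Suppose there is a map f : K → ℝ^m such that for all x,y ∈ K, d(x,y) ≤ ‖f(x)−f(y)‖_p ≤ α·d(x,y), where ‖·‖_p is the ℓ_p norm on ℝ^m. Then there exists a map F : X → ℝ^{m+1} such that for every t ∈ K and every x ∈ X, d(t,x) ≤ 2^{(p−1)/p}·‖F(t)−F(x)‖_p and ‖F(t)−F(x)‖_p ≤ ((2α)^p + 1)^{1/p}·d(t,x). -/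
/-- The ℓ_p norm (for a real exponent `p`) of a vector in `ℝ^m`. -/
noncomputable def lpNorm {m : ℕ} (p : ℝ) (x : Fin m → ℝ) : ℝ :=
  (∑ i, |x i| ^ p) ^ (1 / p)

theorem lpNorm_nonneg {m : ℕ} (p : ℝ) (x : Fin m → ℝ) : 0 ≤ lpNorm p x :=
  Real.rpow_nonneg (Finset.sum_nonneg fun _ _ => Real.rpow_nonneg (abs_nonneg _) _) _

theorem lpNorm_rpow {m : ℕ} {p : ℝ} (hp : p ≠ 0) (x : Fin m → ℝ) :
    lpNorm p x ^ p = ∑ i, |x i| ^ p := by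
  rw [lpNorm, one_div]
  exact Real.rpow_inv_rpow
    (Finset.sum_nonneg fun _ _ => Real.rpow_nonneg (abs_nonneg _) _) hp

theorem lpNorm_cons_sub_cons {m : ℕ} {p : ℝ} (hp : p ≠ 0) (a b : ℝ) (x y : Fin m → ℝ) :
    lpNorm p ((Fin.cons a x : Fin (m + 1) → ℝ) - Fin.cons b y) =
      (|a - b| ^ p + lpNorm p (x - y) ^ p) ^ (1 / p) := by
  rw [lpNorm_rpow hp, lpNorm, Fin.sum_univ_succ]
  simp only [Pi.sub_apply, Fin.cons_zero, Fin.cons_succ]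

theorem add_le_two_rpow_mul_rpow_add_rpow {p a b : ℝ} (hp : 1 ≤ p) (ha : 0 ≤ a) (hb : 0 ≤ b) :
    a + b ≤ 2 ^ ((p - 1) / p) * (a ^ p + b ^ p) ^ (1 / p) := by
  have hp0 : 0 < p := by linarith
  have hsum : 0 ≤ a ^ p + b ^ p := by positivity
  calc a + b = ((a + b) ^ p) ^ (1 / p) := by
        rw [one_div, Real.rpow_rpow_inv (add_nonneg ha hb) hp0.ne']
    _ ≤ (2 ^ (p - 1) * (a ^ p + b ^ p)) ^ (1 / p) := by
        gcongr
        exact mod_cast NNReal.rpow_add_le_mul_rpow_add_rpow ⟨a, ha⟩ ⟨b, hb⟩ hp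
    _ = 2 ^ ((p - 1) / p) * (a ^ p + b ^ p) ^ (1 / p) := by
        rw [Real.mul_rpow (by positivity) hsum, ← Real.rpow_mul (by norm_num), mul_one_div]

theorem rpow_add_rpow_rpow_le {p a b c d : ℝ} (hp : 0 < p) (ha : 0 ≤ a) (hb : 0 ≤ b)
    (hc : 0 ≤ c) (hd : 0 ≤ d) (had : a ≤ d) (hbd : b ≤ c * d) :
    (a ^ p + b ^ p) ^ (1 / p) ≤ (c ^ p + 1) ^ (1 / p) * d := by
  calc (a ^ p + b ^ p) ^ (1 / p) ≤ (d ^ p + (c * d) ^ p) ^ (1 / p) := by gcongr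
    _ = ((c ^ p + 1) * d ^ p) ^ (1 / p) := by
        rw [Real.mul_rpow hc hd]
        ring_nf
    _ = (c ^ p + 1) ^ (1 / p) * d := by
        rw [Real.mul_rpow (by positivity) (by positivity), one_div, Real.rpow_rpow_inv hd hp.ne']

/-- Terminal embedding into ℓ_p: given an embedding of the terminal set `K` into `ℝ^m`
with distortion `α` (in the ℓ_p norm), the whole space embeds into `ℝ^(m+1)` with
terminal distortion `2^((p-1)/p) · ((2α)^p + 1)^(1/p)`. -/
theorem terminal_embedding_lp {X : Type} [MetricSpace X] [Fintype X]
    (K : Set X) (hK : K.Nonempty) (p α : ℝ) (hp : 1 ≤ p) (hα : 1 ≤ α)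
    (m : ℕ) (f : K → Fin m → ℝ)
    (hf : ∀ x y : K,
      dist (x : X) (y : X) ≤ lpNorm p (f x - f y) ∧
      lpNorm p (f x - f y) ≤ α * dist (x : X) (y : X)) :
    ∃ F : X → Fin (m + 1) → ℝ, ∀ t ∈ K, ∀ x : X,
      dist t x ≤ (2 : ℝ) ^ ((p - 1) / p) * lpNorm p (F t - F x) ∧
      lpNorm p (F t - F x) ≤ ((2 * α) ^ p + 1) ^ (1 / p) * dist t x := by
  have hp0 : 0 < p := by linarith
  have hnear : ∀ x : X, ∃ k : K, ∀ t : K, dist (k : X) x ≤ dist (t : X) x := fun x => by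
    have : Nonempty K := hK.to_subtype
    exact Finite.exists_min fun k : K => dist (k : X) x
  choose k hk using hnear
  refine ⟨fun x => Fin.cons (dist (k x : X) x) (f (k x)), fun t ht x => ?_⟩
  have hkt : k t = ⟨t, ht⟩ := by
    have h := hk t ⟨t, ht⟩
    rw [dist_self] at h
    exact Subtype.ext (dist_le_zero.1 h)
  have hkx : dist (k x : X) x ≤ dist t x := hk x ⟨t, ht⟩
  obtain ⟨hlow, hup⟩ := hf ⟨t, ht⟩ (k x)
  simp only [lpNorm_cons_sub_cons hp0.ne', hkt, dist_self, zero_sub, abs_neg, abs_dist]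
  constructor
  · refine le_trans ?_
      (add_le_two_rpow_mul_rpow_add_rpow hp dist_nonneg (lpNorm_nonneg _ _))
    linarith [dist_triangle t (k x : X) x]
  · refine rpow_add_rpow_rpow_le hp0 dist_nonneg (lpNorm_nonneg _ _) (by linarith)
      dist_nonneg hkx (hup.trans ?_)
    have h : dist t (k x : X) ≤ 2 * dist t x := by
      linarith [dist_triangle_right t (k x : X) x]
    calc α * dist t (k x : X) ≤ α * (2 * dist t x) := by gcongr
      _ = 2 * α * dist t x := by ring
end

section
/- There exists a universal constant C > 0 such that for every finite metric space (X,d), every set of terminals K ⊆ X with |K| = k ≥ 2, and every real p ≥ 1, there exist a natural number m ≤ C·log k, a map F : X → ℝ^m, and a constant c > 0 such that for all v ∈ K and u ∈ X, d(v,u) ≤ c·‖F(v)−F(u)‖_p ≤ C·(log k)·d(v,u), where ‖·‖_p is the ℓ_p norm on ℝ^m and log denotes the natural logarithm. -/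
/-- The partition function at inverse temperature `b`, a smooth substitute for the number of
points at distance at most `1 / b` from `x`. -/
noncomputable def softVol {Y : Type*} [MetricSpace Y] [Fintype Y] (b : ℝ) (x : Y) : ℝ :=
  ∑ z, Real.exp (-(b * dist x z))

section SoftVolume

variable {Y : Type*} [MetricSpace Y] [Fintype Y]

lemma one_le_softVol (b : ℝ) (x : Y) : 1 ≤ softVol b x := by
  have h := Finset.single_le_sum (f := fun z => Real.exp (-(b * dist x z)))
    (fun z _ => (Real.exp_pos _).le) (Finset.mem_univ x)
  simpa [softVol] using h

lemma softVol_pos (b : ℝ) (x : Y) : 0 < softVol b x :=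
  zero_lt_one.trans_le (one_le_softVol b x)

lemma log_softVol_nonneg (b : ℝ) (x : Y) : 0 ≤ Real.log (softVol b x) :=
  Real.log_nonneg (one_le_softVol b x)

lemma softVol_anti {b b' : ℝ} (h : b ≤ b') (x : Y) : softVol b' x ≤ softVol b x := by
  unfold softVol
  gcongr

lemma log_softVol_anti {b b' : ℝ} (h : b ≤ b') (x : Y) :
    Real.log (softVol b' x) ≤ Real.log (softVol b x) :=
  Real.log_le_log (softVol_pos _ _) (softVol_anti h x)

lemma log_softVol_le {b : ℝ} (hb : 0 ≤ b) (x : Y) :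
    Real.log (softVol b x) ≤ Real.log (Fintype.card Y) := by
  refine Real.log_le_log (softVol_pos _ _) ((softVol_anti hb x).trans ?_)
  simp [softVol]

lemma softVol_le_exp_mul {b : ℝ} (hb : 0 ≤ b) (x y : Y) :
    softVol b y ≤ Real.exp (b * dist x y) * softVol b x := by
  unfold softVol
  rw [Finset.mul_sum]
  refine Finset.sum_le_sum fun z _ => ?_
  rw [← Real.exp_add]
  refine Real.exp_le_exp.2 ?_
  nlinarith [dist_triangle x y z]

lemma log_softVol_sub_le {b : ℝ} (hb : 0 ≤ b) (x y : Y) :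
    Real.log (softVol b y) - Real.log (softVol b x) ≤ b * dist x y := by
  have h := Real.log_le_log (softVol_pos b y) (softVol_le_exp_mul hb x y)
  rw [Real.log_mul (Real.exp_pos _).ne' (softVol_pos b x).ne', Real.log_exp] at h
  linarith

lemma abs_log_softVol_sub_le {b : ℝ} (hb : 0 ≤ b) (x y : Y) :
    |Real.log (softVol b x) - Real.log (softVol b y)| ≤ b * dist x y := by
  rw [abs_le]
  have h1 := log_softVol_sub_le hb x y
  have h2 := log_softVol_sub_le hb y x
  rw [dist_comm] at h2
  constructor <;> linarith

/-- Jensen's inequality for the Gibbs measure of inverse temperature `2 * b` centred at `x`. -/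
lemma mean_dist_le (b : ℝ) (x : Y) :
    b * (∑ z, Real.exp (-(2 * b * dist x z)) * dist x z) ≤
      (Real.log (softVol b x) - Real.log (softVol (2 * b) x)) * softVol (2 * b) x := by
  set V := softVol (2 * b) x with hV
  set M := ∑ z, Real.exp (-(2 * b * dist x z)) * dist x z with hM
  have hVpos : 0 < V := softVol_pos _ _
  have key : Real.exp (b * M / V) * V ≤ softVol b x := by
    have hsum : Real.exp (b * M / V) * V = ∑ z, Real.exp (-(2 * b * dist x z)) *
        (Real.exp (b * M / V) * (1 + (b * dist x z - b * M / V))) := by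
      have : ∀ z, Real.exp (-(2 * b * dist x z)) *
          (Real.exp (b * M / V) * (1 + (b * dist x z - b * M / V))) =
          Real.exp (b * M / V) * (1 - b * M / V) * Real.exp (-(2 * b * dist x z)) +
          Real.exp (b * M / V) * b * (Real.exp (-(2 * b * dist x z)) * dist x z) := by
        intro z; ring
      simp_rw [this]
      rw [Finset.sum_add_distrib, ← Finset.mul_sum, ← Finset.mul_sum, ← hM]
      change _ = _ * V + _
      field_simp
      ring
    rw [hsum]
    unfold softVol
    refine Finset.sum_le_sum fun z _ => ?_
    have h1 : Real.exp (-(b * dist x z)) = Real.exp (-(2 * b * dist x z)) *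
        (Real.exp (b * M / V) * Real.exp (b * dist x z - b * M / V)) := by
      rw [← Real.exp_add, ← Real.exp_add]; congr 1; ring
    rw [h1]
    gcongr
    linarith [Real.add_one_le_exp (b * dist x z - b * M / V)]
  have h2 := Real.log_le_log (by positivity) key
  rw [Real.log_mul (Real.exp_pos _).ne' hVpos.ne', Real.log_exp] at h2
  have h3 : b * M / V ≤ Real.log (softVol b x) - Real.log V := by linarith
  rwa [div_le_iff₀ hVpos] at h3

/-- Markov's inequality for the Gibbs measure of inverse temperature `2 * b` centred at `x`. -/
lemma far_mass_le {b r κ : ℝ} (hb : 0 < b) (hr : 0 < r) (x : Y)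
    (h : Real.log (softVol b x) - Real.log (softVol (2 * b) x) ≤ κ * (b * r))
    (s : Finset Y) (hs : ∀ z ∈ s, r ≤ dist x z) :
    ∑ z ∈ s, Real.exp (-(2 * b * dist x z)) ≤ κ * softVol (2 * b) x := by
  have h1 := mean_dist_le b x
  have hV := softVol_pos (2 * b) x
  have h2 : r * ∑ z ∈ s, Real.exp (-(2 * b * dist x z)) ≤
      ∑ z, Real.exp (-(2 * b * dist x z)) * dist x z := by
    rw [Finset.mul_sum]
    calc _ ≤ ∑ z ∈ s, Real.exp (-(2 * b * dist x z)) * dist x z := by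
          refine Finset.sum_le_sum fun z hz => ?_
          rw [mul_comm]
          gcongr
          exact hs z hz
      _ ≤ _ := Finset.sum_le_sum_of_subset_of_nonneg (Finset.subset_univ _)
          fun z _ _ => by positivity
  have h3 : b * r * ∑ z ∈ s, Real.exp (-(2 * b * dist x z)) ≤
      b * r * (κ * softVol (2 * b) x) := by nlinarith
  exact le_of_mul_le_mul_left h3 (by positivity)

/-- Below the scale of a pair, the soft volume grows noticeably around one of its two points. -/
lemma growth_or_growth {b : ℝ} (hb : 0 < b) (x y : Y) (h : 2 * b * dist x y ≤ 1) :
    2 * b * dist x y / 32 ≤ Real.log (softVol b x) - Real.log (softVol (2 * b) x) ∨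
    2 * b * dist x y / 32 ≤ Real.log (softVol b y) - Real.log (softVol (2 * b) y) := by
  by_contra! hcon
  obtain ⟨hx, hy⟩ := hcon
  set d := dist x y with hd
  have hVx := softVol_pos (2 * b) x
  have hVy := softVol_pos (2 * b) y
  set Vx := softVol (2 * b) x with hVxd
  set Vy := softVol (2 * b) y
  have he : Real.exp (2 * b * d) ≤ 2.7182818286 :=
    (Real.exp_le_exp.2 h).trans Real.exp_one_lt_d9.le
  have hVyx : Vy ≤ Real.exp (2 * b * d) * Vx := softVol_le_exp_mul (by positivity) x y
  have h1 := mean_dist_le b x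
  have h2 := mean_dist_le b y
  set Mx := ∑ z, Real.exp (-(2 * b * dist x z)) * dist x z
  set My := ∑ z, Real.exp (-(2 * b * dist y z)) * dist y z
  have h3 : d * Vx ≤ Mx + Real.exp (2 * b * d) * My := by
    simp only [hVxd, softVol, Mx, My, Finset.mul_sum]
    rw [← Finset.sum_add_distrib]
    refine Finset.sum_le_sum fun z _ => ?_
    have h5 : Real.exp (-(2 * b * dist x z)) ≤
        Real.exp (2 * b * d) * Real.exp (-(2 * b * dist y z)) := by
      rw [← Real.exp_add]
      refine Real.exp_le_exp.2 ?_
      nlinarith [dist_triangle_left y z x, dist_comm x y, dist_triangle y x z]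
    have h6 : d ≤ dist x z + dist y z := dist_triangle_right x y z
    calc _ ≤ (dist x z + dist y z) * Real.exp (-(2 * b * dist x z)) := by gcongr
      _ ≤ _ := by nlinarith [dist_nonneg (x := y) (y := z)]
  have hd0 : 0 ≤ d := dist_nonneg
  have hd1 : 0 < d := by
    rcases hd0.lt_or_eq with h | h
    · exact h
    · rw [← h] at hx
      have := log_softVol_anti (by linarith : b ≤ 2 * b) x
      simp at hx
      linarith
  have h7 : b * Mx ≤ 2 * b * d / 32 * Vx := h1.trans (by gcongr)
  have h8 : b * My ≤ 2 * b * d / 32 * Vy := h2.trans (by gcongr)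
  have h7' : Mx ≤ d / 16 * Vx := le_of_mul_le_mul_left (by linarith) hb
  have h8' : My ≤ d / 16 * Vy := le_of_mul_le_mul_left (by linarith) hb
  set E := Real.exp (2 * b * d)
  have hE : 0 < E := Real.exp_pos _
  have h10 : E * My ≤ d / 16 * (E * E) * Vx := by
    calc E * My ≤ E * (d / 16 * (E * Vx)) := by gcongr; exact h8'.trans (by gcongr)
      _ = _ := by ring
  have h11 : E * E ≤ 8 := by nlinarith
  have h12 : d / 16 * (E * E) * Vx ≤ d / 16 * 8 * Vx := by gcongr
  nlinarith [mul_pos hd1 hVx]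

end SoftVolume

lemma one_sub_sum_le_prod {ι : Type*} (s : Finset ι) (f : ι → ℝ) (h0 : ∀ i ∈ s, 0 ≤ f i)
    (h1 : ∀ i ∈ s, f i ≤ 1) : 1 - ∑ i ∈ s, f i ≤ ∏ i ∈ s, (1 - f i) := by
  classical
  induction s using Finset.induction_on with
  | empty => simp
  | insert a s ha ih =>
    rw [Finset.sum_insert ha, Finset.prod_insert ha]
    have ih' := ih (fun i hi => h0 i (Finset.mem_insert_of_mem hi))
      (fun i hi => h1 i (Finset.mem_insert_of_mem hi))
    have ha0 := h0 a (Finset.mem_insert_self _ _)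
    have ha1 := h1 a (Finset.mem_insert_self _ _)
    have hs : 0 ≤ ∑ i ∈ s, f i := Finset.sum_nonneg fun i hi => h0 i (Finset.mem_insert_of_mem hi)
    nlinarith [mul_le_mul_of_nonneg_left ih' (sub_nonneg.2 ha1), mul_nonneg ha0 hs]

section UnitCube

open MeasureTheory

/-- The uniform probability measure on the unit cube. -/
noncomputable def cubeMeasure (Y : Type*) [Fintype Y] : Measure (Y → ℝ) :=
  Measure.pi fun _ => volume.restrict (Set.Icc 0 1)

instance (Y : Type*) [Fintype Y] : IsProbabilityMeasure (cubeMeasure Y) := by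
  have : IsProbabilityMeasure (volume.restrict (Set.Icc (0 : ℝ) 1)) := ⟨by simp⟩
  unfold cubeMeasure
  infer_instance

/-- Some coordinate in `s` is at most its upper threshold, while all coordinates exceed their
lower thresholds. -/
def thresholdEvent {Y : Type*} (s : Finset Y) (α β : Y → ℝ) : Set (Y → ℝ) :=
  {u | (∃ z ∈ s, u z ≤ α z) ∧ ∀ w, β w < u w}

section Probability

variable {Y : Type*} [Fintype Y]

lemma measurableSet_thresholdEvent (s : Finset Y) (α β : Y → ℝ) :
    MeasurableSet (thresholdEvent s α β) := by
  have : thresholdEvent s α β =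
      (⋃ z ∈ s, {u : Y → ℝ | u z ≤ α z}) ∩ ⋂ w, {u : Y → ℝ | β w < u w} := by
    ext u; simp [thresholdEvent]
  rw [this]
  refine MeasurableSet.inter (Finset.measurableSet_biUnion _ fun z _ => ?_)
    (MeasurableSet.iInter fun w => ?_)
  · exact measurableSet_le (measurable_pi_apply z) measurable_const
  · exact measurableSet_lt measurable_const (measurable_pi_apply w)

lemma cubeMeasure_real_pi_Ioc {l r : Y → ℝ} (hl : ∀ z, 0 ≤ l z) (hr : ∀ z, r z ≤ 1) :
    ∏ z, (r z - l z) ⊔ 0 = (cubeMeasure Y).real (Set.univ.pi fun z => Set.Ioc (l z) (r z)) := by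
  rw [measureReal_def, cubeMeasure, Measure.pi_pi, ENNReal.toReal_prod]
  refine Finset.prod_congr rfl fun z _ => ?_
  have hsub : Set.Ioc (l z) (r z) ⊆ Set.Icc 0 1 := fun t ht =>
    ⟨(hl z).trans ht.1.le, ht.2.trans (hr z)⟩
  rw [Measure.restrict_apply measurableSet_Ioc, Set.inter_eq_left.2 hsub, Real.volume_Ioc,
    ENNReal.toReal_ofReal']

lemma le_measureReal_thresholdEvent (s : Finset Y) (α β : Y → ℝ) (hα : ∀ z, 0 ≤ α z)
    (hβ : ∀ z, 0 ≤ β z) (hsum : ∑ z, (α z + β z) ≤ 1) :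
    (1 - ∑ z, (α z + β z)) * ∑ z ∈ s, (α z - β z) ≤
      (cubeMeasure Y).real (thresholdEvent s α β) := by
  classical
  have hle : ∀ z, α z + β z ≤ 1 := fun z => le_trans
    (Finset.single_le_sum (f := fun z => α z + β z)
      (fun i _ => add_nonneg (hα i) (hβ i)) (Finset.mem_univ z)) hsum
  let l : Y → Y → ℝ := fun z w => if w = z then β w else max (α w) (β w)
  let r : Y → Y → ℝ := fun z w => if w = z then α w else 1
  let B : Y → Set (Y → ℝ) := fun z => Set.univ.pi fun w => Set.Ioc (l z w) (r z w)
  have hB : ∀ z, (1 - ∑ z, (α z + β z)) * (α z - β z) ≤ (cubeMeasure Y).real (B z) := by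
    intro z
    rcases le_total (α z) (β z) with h | h
    · exact (mul_nonpos_of_nonneg_of_nonpos (by linarith) (by linarith)).trans measureReal_nonneg
    rw [← cubeMeasure_real_pi_Ioc]
    · rw [← Finset.mul_prod_erase _ _ (Finset.mem_univ z), mul_comm]
      have h1 : (r z z - l z z) ⊔ 0 = α z - β z := by
        simp only [l, r, if_true]
        exact sup_eq_left.2 (by linarith)
      rw [h1]
      refine mul_le_mul_of_nonneg_left ?_ (by linarith)
      calc 1 - ∑ z, (α z + β z) ≤ 1 - ∑ w ∈ Finset.univ.erase z, (α w + β w) := by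
            have := Finset.sum_le_sum_of_subset_of_nonneg (f := fun w => α w + β w)
              (Finset.subset_univ (Finset.univ.erase z))
              (fun i _ _ => add_nonneg (hα i) (hβ i))
            linarith
        _ ≤ ∏ w ∈ Finset.univ.erase z, (1 - (α w + β w)) :=
            one_sub_sum_le_prod _ _ (fun i _ => add_nonneg (hα i) (hβ i)) (fun i _ => hle i)
        _ ≤ _ := by
            refine Finset.prod_le_prod (fun i _ => by linarith [hle i]) fun w hw => ?_
            have hw' : w ≠ z := Finset.ne_of_mem_erase hw
            simp only [l, r, if_neg hw']
            refine le_trans ?_ le_sup_left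
            have := max_le_add_of_nonneg (hα w) (hβ w)
            linarith
    · intro w
      simp only [l]
      split_ifs
      · exact hβ w
      · exact (hα w).trans (le_max_left _ _)
    · intro w
      simp only [r]
      split_ifs
      · linarith [hle w, hβ w]
      · exact le_rfl
  have hsub : (⋃ z ∈ s, B z) ⊆ thresholdEvent s α β := by
    intro u hu
    simp only [Set.mem_iUnion, exists_prop] at hu
    obtain ⟨z, hz, hu⟩ := hu
    refine ⟨⟨z, hz, ?_⟩, fun w => ?_⟩
    · have := (hu z (Set.mem_univ _)).2
      simpa [r] using this
    · have := (hu w (Set.mem_univ _)).1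
      simp only [l] at this
      split_ifs at this
      · exact this
      · exact (le_max_right _ _).trans_lt this
  have hdisj : (s : Set Y).PairwiseDisjoint B := by
    intro z _ z' _ hne
    refine Set.disjoint_left.2 fun u hu hu' => ?_
    have h1 := (hu z (Set.mem_univ _)).2
    have h2 := (hu' z (Set.mem_univ _)).1
    simp only [l, r, if_neg hne, if_true] at h1 h2
    exact absurd (((le_max_left _ _).trans_lt h2).trans_le h1) (lt_irrefl _)
  calc _ = ∑ z ∈ s, (1 - ∑ z, (α z + β z)) * (α z - β z) := Finset.mul_sum _ _ _
    _ ≤ ∑ z ∈ s, (cubeMeasure Y).real (B z) := Finset.sum_le_sum fun z _ => hB z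
    _ = (cubeMeasure Y).real (⋃ z ∈ s, B z) := by
        rw [measureReal_biUnion_finset hdisj]
        exact fun z _ => MeasurableSet.univ_pi fun w => measurableSet_Ioc
    _ ≤ _ := measureReal_mono hsub

end Probability

open Classical in
lemma exists_weight_le_of_le_measureReal {Ω ι : Type*} [MeasurableSpace Ω] [Fintype ι]
    (μ : Measure Ω) [IsProbabilityMeasure μ] (E : ι → Set Ω) (hE : ∀ i, MeasurableSet (E i))
    {q : ℝ} (hq : ∀ i, q ≤ μ.real (E i)) (w : ι → ℝ) (hw : ∀ i, 0 ≤ w i) :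
    ∃ ω, q * ∑ i, w i ≤ ∑ i with ω ∈ E i, w i := by
  have hInt : ∀ i ∈ Finset.univ, Integrable ((E i).indicator fun _ => w i) μ :=
    fun i _ => (integrable_const _).indicator (hE i)
  obtain ⟨ω, hω⟩ := exists_integral_le (integrable_finsetSum _ hInt)
  refine ⟨ω, ?_⟩
  rw [integral_finsetSum _ hInt] at hω
  calc q * ∑ i, w i = ∑ i, q * w i := Finset.mul_sum _ _ _
    _ ≤ ∑ i, ∫ a, (E i).indicator (fun _ => w i) a ∂μ := by
        refine Finset.sum_le_sum fun i _ => ?_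
        rw [integral_indicator_const _ (hE i), smul_eq_mul]
        exact mul_le_mul_of_nonneg_right (hq i) (hw i)
    _ ≤ _ := hω
    _ = _ := by
        rw [Finset.sum_filter]
        refine Finset.sum_congr rfl fun i _ => ?_
        simp [Set.indicator_apply]

end UnitCube

open Classical in
/-- Random signs: flipping the sign of one summand keeps a sum at least that large half the
time. -/
lemma exists_signs {ι J : Type*} [Fintype ι] [Fintype J] (s : Finset ι) (w : ι → ℝ)
    (hw : ∀ i, 0 ≤ w i) (a : ι → J → ℝ) (j : ι → J) :
    ∃ ε : J → ℝ, (∀ k, |ε k| = 1) ∧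
      (∑ i ∈ s, w i) / 2 ≤ ∑ i ∈ s with |a i (j i)| ≤ |∑ k, ε k * a i k|, w i := by
  let σ : (J → Bool) → J → ℝ := fun e k => if e k then 1 else -1
  let S : (J → Bool) → ι → ℝ := fun e i => ∑ k, σ e k * a i k
  have hpair : ∀ i, ∀ e : J → Bool, w i ≤
      (if |a i (j i)| ≤ |S e i| then w i else 0) +
      (if |a i (j i)| ≤ |S (Function.update e (j i) (!e (j i))) i| then w i else 0) := by
    intro i e
    have hdiff : S e i - S (Function.update e (j i) (!e (j i))) i = 2 * (σ e (j i) * a i (j i)) := by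
      simp only [S]
      rw [← Finset.sum_sub_distrib, Finset.sum_eq_single (j i)]
      · cases h : e (j i) <;> simp [σ, h] <;> ring
      · intro k _ hk
        simp [σ, Function.update_of_ne hk]
      · simp
    have habs : |σ e (j i) * a i (j i)| = |a i (j i)| := by
      rw [abs_mul]
      cases h : e (j i) <;> simp [σ, h]
    have h2 : 2 * |a i (j i)| ≤ |S e i| + |S (Function.update e (j i) (!e (j i))) i| := by
      rw [← habs]
      calc 2 * |σ e (j i) * a i (j i)| = |2 * (σ e (j i) * a i (j i))| := by
            rw [abs_mul]; norm_num
        _ ≤ _ := by rw [← hdiff]; exact abs_sub _ _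
    have := hw i
    split_ifs <;> linarith
  have hflip : ∀ i, ∑ e : J → Bool,
      (if |a i (j i)| ≤ |S (Function.update e (j i) (!e (j i))) i| then w i else 0) =
      ∑ e : J → Bool, (if |a i (j i)| ≤ |S e i| then w i else 0) := by
    intro i
    have hinv : Function.Involutive fun e : J → Bool => Function.update e (j i) (!e (j i)) := by
      intro e; simp
    exact Equiv.sum_comp hinv.toPerm (fun e => if |a i (j i)| ≤ |S e i| then w i else 0)
  have htot : ∑ e : J → Bool, (∑ i ∈ s, w i) / 2 ≤
      ∑ e : J → Bool, ∑ i ∈ s with |a i (j i)| ≤ |S e i|, w i := by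
    simp_rw [Finset.sum_filter]
    rw [Finset.sum_comm]
    simp_rw [Finset.sum_div]
    rw [Finset.sum_comm]
    refine Finset.sum_le_sum fun i _ => ?_
    have := Finset.sum_le_sum fun e (_ : e ∈ (Finset.univ : Finset (J → Bool))) => hpair i e
    rw [Finset.sum_add_distrib, hflip] at this
    rw [← Finset.sum_div]
    linarith
  obtain ⟨e, -, he⟩ := Finset.exists_le_of_sum_le Finset.univ_nonempty htot
  refine ⟨σ e, fun k => ?_, he⟩
  simp only [σ]
  split_ifs <;> simp

open Classical in
/-- Multiplicative weights: if for every weighting of the constraints some member of the family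
satisfies a `q`-fraction of the weight, then some sequence satisfies every constraint often. -/
lemma exists_sequence_of_weighted {A ι : Type*} [Fintype ι] (good : A → ι → Prop) {q : ℝ}
    (hq : q ≤ 2)
    (h : ∀ w : ι → ℝ, (∀ i, 0 ≤ w i) → ∃ a, q * ∑ i, w i ≤ ∑ i with good a i, w i) (D : ℕ) :
    ∃ f : Fin D → A,
      ∑ i, (1 / 2 : ℝ) ^ (Finset.univ.filter fun t => good (f t) i).card ≤
        (1 - q / 2) ^ D * Fintype.card ι := by
  induction D with
  | zero => exact ⟨Fin.elim0, by simp⟩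
  | succ D ih =>
    obtain ⟨f, hf⟩ := ih
    set w : ι → ℝ := fun i => (1 / 2 : ℝ) ^ (Finset.univ.filter fun t => good (f t) i).card with hw
    obtain ⟨a, ha⟩ := h w fun i => by positivity
    refine ⟨Fin.cons a f, ?_⟩
    have hstep : ∀ i, (1 / 2 : ℝ) ^ (Finset.univ.filter
        fun t => good ((Fin.cons a f : Fin (D + 1) → A) t) i).card =
        w i - (if good a i then w i else 0) / 2 := by
      intro i
      rw [Fin.card_filter_univ_succ, hw]
      simp only [Fin.cons_zero, Fin.cons_succ]
      split_ifs
      · rw [pow_succ]; ring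
      · ring
    simp_rw [hstep]
    rw [Finset.sum_sub_distrib, ← Finset.sum_div, ← Finset.sum_filter]
    calc _ ≤ (1 - q / 2) * ∑ i, w i := by linarith
      _ ≤ (1 - q / 2) * ((1 - q / 2) ^ D * Fintype.card ι) := by
          gcongr
          linarith
      _ = _ := by ring

/-- The logarithmic growth of the soft volume between the scales `1 / (2 * b)` and `1 / b`. -/
noncomputable def growth {Y : Type*} [MetricSpace Y] [Fintype Y] (b : ℝ) (x : Y) : ℝ :=
  Real.log (softVol b x) - Real.log (softVol (2 * b) x)

/-- A Lipschitz cutoff for the point process with logarithmic heights `-log (u z)`. -/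
noncomputable def cutoff {Y : Type*} [MetricSpace Y] [Fintype Y] (b : ℝ) (u : Y → ℝ) (x : Y) : ℝ :=
  max 0 (min 1 ((⨆ z, (-Real.log (u z) - b * dist x z)) - Real.log (softVol b x) - Real.log 4))

/-- The distance scale carried by `growth b x`, truncated where the growth is negligible. -/
noncomputable def amplitude {Y : Type*} [MetricSpace Y] [Fintype Y] (b : ℝ) (x : Y) : ℝ :=
  max (growth b x - 1 / 128) 0 / (2 * b)

section ScaleFunctions

variable {Y : Type*} [MetricSpace Y] [Fintype Y]

lemma growth_nonneg {b : ℝ} (hb : 0 ≤ b) (x : Y) : 0 ≤ growth b x :=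
  sub_nonneg.2 (log_softVol_anti (by linarith) x)

lemma abs_growth_sub_le {b : ℝ} (hb : 0 ≤ b) (x y : Y) :
    |growth b x - growth b y| ≤ 3 * b * dist x y := by
  have h1 := abs_le.1 (abs_log_softVol_sub_le hb x y)
  have h2 := abs_le.1 (abs_log_softVol_sub_le (by linarith : 0 ≤ 2 * b) x y)
  unfold growth
  rw [abs_le]
  constructor <;> linarith [h1.1, h1.2, h2.1, h2.2]

lemma iSup_sub_dist_le {b : ℝ} (hb : 0 ≤ b) (g : Y → ℝ) (x y : Y) :
    (⨆ z, (g z - b * dist x z)) ≤ (⨆ z, (g z - b * dist y z)) + b * dist x y := by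
  have : Nonempty Y := ⟨x⟩
  refine ciSup_le fun z => ?_
  have h := le_ciSup (Set.finite_range fun z => g z - b * dist y z).bddAbove z
  have h2 := mul_le_mul_of_nonneg_left (dist_triangle y x z) hb
  rw [dist_comm y x] at h2
  linarith

lemma cutoff_nonneg (b : ℝ) (u : Y → ℝ) (x : Y) : 0 ≤ cutoff b u x := le_max_left _ _

lemma cutoff_le_one (b : ℝ) (u : Y → ℝ) (x : Y) : cutoff b u x ≤ 1 :=
  max_le zero_le_one (min_le_left _ _)

lemma abs_cutoff_sub_le {b : ℝ} (hb : 0 ≤ b) (u : Y → ℝ) (x y : Y) :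
    |cutoff b u x - cutoff b u y| ≤ 2 * b * dist x y := by
  unfold cutoff
  refine (abs_max_sub_max_le_max _ _ _ _).trans (max_le (by simp; positivity) ?_)
  refine (abs_min_sub_min_le_max _ _ _ _).trans (max_le (by simp; positivity) ?_)
  have h1 := abs_le.1 (abs_log_softVol_sub_le hb x y)
  have h2 := iSup_sub_dist_le hb (fun z => -Real.log (u z)) x y
  have h3 := iSup_sub_dist_le hb (fun z => -Real.log (u z)) y x
  rw [dist_comm y x] at h3
  rw [abs_le]
  constructor <;> linarith [h1.1, h1.2]

lemma amplitude_nonneg {b : ℝ} (hb : 0 ≤ b) (x : Y) : 0 ≤ amplitude b x :=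
  div_nonneg (le_max_right _ _) (by linarith)

lemma amplitude_mul_le {b : ℝ} (hb : 0 < b) (x : Y) : amplitude b x * (2 * b) ≤ growth b x := by
  unfold amplitude
  rw [div_mul_cancel₀ _ (by positivity)]
  exact max_le (by linarith) (growth_nonneg hb.le x)

lemma abs_amplitude_sub_le {b : ℝ} (hb : 0 < b) (x y : Y) :
    |amplitude b x - amplitude b y| ≤ 192 * (growth b x + growth b y) * dist x y := by
  have hx := growth_nonneg hb.le x
  have hy := growth_nonneg hb.le y
  have hd : 0 ≤ dist x y := dist_nonneg
  by_cases h : growth b x ≤ 1 / 128 ∧ growth b y ≤ 1 / 128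
  · rw [amplitude, amplitude, max_eq_right (by linarith [h.1]), max_eq_right (by linarith [h.2])]
    simp only [sub_self, abs_zero]
    positivity
  have hsum : 1 ≤ 128 * (growth b x + growth b y) := by
    by_contra! hc
    exact h ⟨by linarith, by linarith⟩
  have h1 : |amplitude b x - amplitude b y| ≤ 3 * b * dist x y / (2 * b) := by
    unfold amplitude
    rw [← sub_div, abs_div, abs_of_pos (by positivity : 0 < 2 * b)]
    gcongr
    refine (abs_max_sub_max_le_abs _ _ _).trans ?_
    rw [sub_sub_sub_cancel_right]
    exact abs_growth_sub_le hb.le x y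
  have h2 : 3 * b * dist x y / (2 * b) = 3 / 2 * dist x y := by field_simp
  nlinarith

lemma abs_scale_sub_le {b : ℝ} (hb : 0 < b) (u : Y → ℝ) (x y : Y) :
    |amplitude b x * cutoff (4 * b) u x - amplitude b y * cutoff (4 * b) u y| ≤
      (196 * growth b x + 192 * growth b y) * dist x y := by
  have h1 := abs_amplitude_sub_le hb x y
  have h2 := abs_cutoff_sub_le (by linarith : 0 ≤ 4 * b) u x y
  have h3 := amplitude_mul_le hb x
  have ha := amplitude_nonneg hb.le x
  have e : amplitude b x * cutoff (4 * b) u x - amplitude b y * cutoff (4 * b) u y =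
      amplitude b x * (cutoff (4 * b) u x - cutoff (4 * b) u y) +
      (amplitude b x - amplitude b y) * cutoff (4 * b) u y := by ring
  rw [e]
  refine (abs_add_le _ _).trans ?_
  rw [abs_mul, abs_mul, abs_of_nonneg ha, abs_of_nonneg (cutoff_nonneg _ _ _)]
  have h4 : amplitude b x * |cutoff (4 * b) u x - cutoff (4 * b) u y| ≤
      4 * growth b x * dist x y := by
    calc _ ≤ amplitude b x * (2 * (4 * b) * dist x y) := by gcongr
      _ = 4 * (amplitude b x * (2 * b)) * dist x y := by ring
      _ ≤ _ := by gcongr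
  have h5 : |amplitude b x - amplitude b y| * cutoff (4 * b) u y ≤
      |amplitude b x - amplitude b y| :=
    mul_le_of_le_one_right (abs_nonneg _) (cutoff_le_one _ _ _)
  linarith

lemma cutoff_eq_one {b : ℝ} {u : Y → ℝ} {x z : Y} (hpos : 0 < u z)
    (h : u z ≤ Real.exp (-(b * dist x z)) / (12 * softVol b x)) : cutoff b u x = 1 := by
  have hV := softVol_pos b x
  have h1 := Real.log_le_log hpos h
  rw [Real.log_div (Real.exp_pos _).ne' (by positivity), Real.log_exp,
    Real.log_mul (by norm_num) hV.ne'] at h1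
  have h2 : Real.log 12 = Real.log 3 + Real.log 4 := by
    rw [← Real.log_mul (by norm_num) (by norm_num)]; norm_num
  have h3 : 1 ≤ Real.log 3 := by
    rw [Real.le_log_iff_exp_le (by norm_num)]
    linarith [Real.exp_one_lt_d9]
  have h4 := le_ciSup (Set.finite_range fun z => -Real.log (u z) - b * dist x z).bddAbove z
  unfold cutoff
  rw [min_eq_left (by linarith), max_eq_right zero_le_one]

lemma cutoff_eq_zero {b : ℝ} {u : Y → ℝ} {y : Y}
    (h : ∀ z, Real.exp (-(b * dist y z)) / (4 * softVol b y) < u z) : cutoff b u y = 0 := by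
  have hV := softVol_pos b y
  have : Nonempty Y := ⟨y⟩
  have h1 : (⨆ z, (-Real.log (u z) - b * dist y z)) ≤ Real.log 4 + Real.log (softVol b y) := by
    refine ciSup_le fun z => ?_
    have h2 := Real.log_le_log (by positivity) (h z).le
    rw [Real.log_div (Real.exp_pos _).ne' (by positivity), Real.log_exp,
      Real.log_mul (by norm_num) hV.ne'] at h2
    linarith
  unfold cutoff
  exact max_eq_left ((min_le_right _ _).trans (by linarith))

/-- At the critical scale of a pair, the cutoff separates the two points with constant
probability. -/
lemma exists_separating_event {b : ℝ} (hb : 0 < b) {x y : Y} (hxy : x ≠ y)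
    (hfine : 1 ≤ 4 * b * dist x y) (hx : 2 * b * dist x y / 32 ≤ growth b x)
    (hx' : growth (2 * b) x ≤ 2 * (2 * b) * dist x y / 32)
    (hy' : growth (2 * b) y ≤ 2 * (2 * b) * dist x y / 32) :
    ∃ E : Set (Y → ℝ), MeasurableSet E ∧ 1 / 36 ≤ (cubeMeasure Y).real E ∧
      ∀ u ∈ E, dist x y / 64 ≤
        |amplitude b x * cutoff (4 * b) u x - amplitude b y * cutoff (4 * b) u y| := by
  classical
  set d := dist x y with hd
  have hd0 : 0 < d := dist_pos.2 hxy
  set Vx := softVol (4 * b) x with hVx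
  set Vy := softVol (4 * b) y with hVy
  have hVx0 : 0 < Vx := softVol_pos _ _
  have hVy0 : 0 < Vy := softVol_pos _ _
  have h4 : 2 * (2 * b) = 4 * b := by ring
  let α : Y → ℝ := fun z => Real.exp (-(4 * b * dist x z)) / (12 * Vx)
  let β : Y → ℝ := fun z => Real.exp (-(4 * b * dist y z)) / (4 * Vy)
  let s : Finset Y := Finset.univ.filter fun z => dist x z < d / 2
  have hαpos : ∀ z, 0 ≤ α z := fun z => by positivity
  have hβpos : ∀ z, 0 ≤ β z := fun z => by positivity
  have hαsum : ∑ z, α z = 1 / 12 := by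
    simp only [α]
    rw [← Finset.sum_div]
    change Vx / _ = _
    field_simp
  have hβsum : ∑ z, β z = 1 / 4 := by
    simp only [β]
    rw [← Finset.sum_div]
    change Vy / _ = _
    field_simp
  have hαs : 7 / 96 ≤ ∑ z ∈ s, α z := by
    have hsplit := Finset.sum_filter_add_sum_filter_not Finset.univ (fun z => dist x z < d / 2) α
    have hfar := far_mass_le (κ := 1 / 8) (r := d / 2) (by positivity : 0 < 2 * b) (by positivity) x
      (by change growth (2 * b) x ≤ _; linarith)
      (Finset.univ.filter fun z => ¬ dist x z < d / 2) (by simp)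
    rw [h4] at hfar
    have : ∑ z with ¬ dist x z < d / 2, α z ≤ 1 / 96 := by
      simp only [α]
      rw [← Finset.sum_div, div_le_iff₀ (by positivity)]
      linarith
    simp only [s]
    linarith
  have hβs : ∑ z ∈ s, β z ≤ 1 / 32 := by
    have hfar := far_mass_le (κ := 1 / 8) (r := d / 2) (by positivity : 0 < 2 * b) (by positivity) y
      (by change growth (2 * b) y ≤ _; linarith) s (by
        intro z hz
        have hz' : dist x z < d / 2 := (Finset.mem_filter.1 hz).2
        have := dist_triangle_right x y z
        linarith)
    rw [h4] at hfar
    simp only [β]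
    rw [← Finset.sum_div, div_le_iff₀ (by positivity)]
    linarith
  refine ⟨thresholdEvent s α β, measurableSet_thresholdEvent _ _ _, ?_, ?_⟩
  · have h := le_measureReal_thresholdEvent s α β hαpos hβpos
      (by rw [Finset.sum_add_distrib]; linarith)
    rw [Finset.sum_add_distrib, Finset.sum_sub_distrib, hαsum, hβsum] at h
    linarith
  · rintro u ⟨⟨z, -, hz⟩, hu⟩
    rw [cutoff_eq_one ((hβpos z).trans_lt (hu z)) hz, cutoff_eq_zero hu]
    rw [mul_zero, sub_zero, mul_one]
    refine le_trans ?_ (le_abs_self _)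
    unfold amplitude
    rw [le_div_iff₀ (by positivity)]
    refine le_trans ?_ (le_max_left _ _)
    linarith

end ScaleFunctions

section RandomMap

variable {Y : Type*} [MetricSpace Y] [Fintype Y]

lemma exists_critical_scale {b : ℝ} (hb : 0 < b) (N : ℕ) {x y : Y} (hxy : x ≠ y)
    (hlow : 2 * b * dist x y ≤ 1)
    (hhigh : Real.log (Fintype.card Y) < 2 * (b * 2 ^ N) * dist x y / 32) :
    ∃ j : Fin N, ∃ E : Set (Y → ℝ), MeasurableSet E ∧ 1 / 36 ≤ (cubeMeasure Y).real E ∧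
      ∀ u ∈ E, dist x y / 64 ≤
        |amplitude (b * 2 ^ (j : ℕ)) x * cutoff (4 * (b * 2 ^ (j : ℕ))) u x -
          amplitude (b * 2 ^ (j : ℕ)) y * cutoff (4 * (b * 2 ^ (j : ℕ))) u y| := by
  let P : ℕ → Prop := fun j => 2 * (b * 2 ^ j) * dist x y / 32 ≤ growth (b * 2 ^ j) x ∨
    2 * (b * 2 ^ j) * dist x y / 32 ≤ growth (b * 2 ^ j) y
  have hP0 : P 0 := by simpa [P, growth] using growth_or_growth hb x y hlow
  have hgN : ∀ z : Y, growth (b * 2 ^ N) z ≤ Real.log (Fintype.card Y) := fun z => by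
    have h1 := log_softVol_le (by positivity : 0 ≤ b * 2 ^ N) z
    have h2 := log_softVol_nonneg (2 * (b * 2 ^ N)) z
    unfold growth
    linarith
  have hPN : ¬ P N := by
    rintro (h | h)
    · linarith [hgN x]
    · linarith [hgN y]
  obtain ⟨j, hjN, hj, hj'⟩ : ∃ j < N, P j ∧ ¬ P (j + 1) := by
    by_contra! hc
    have : ∀ k ≤ N, P k := fun k => by
      induction k with
      | zero => exact fun _ => hP0
      | succ k ih => exact fun hk => hc k hk (ih (Nat.le_of_succ_le hk))
    exact hPN (this N le_rfl)
  have hsucc : b * 2 ^ (j + 1) = 2 * (b * 2 ^ j) := by ring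
  simp only [P, hsucc, not_or, not_le] at hj'
  have hB : 0 < b * 2 ^ j := by positivity
  set B := b * 2 ^ j with hBdef
  have hfine : 1 ≤ 4 * B * dist x y := by
    by_contra! hc
    rcases growth_or_growth (by positivity : 0 < 2 * B) x y (by linarith) with h | h
    · exact absurd hj'.1 (not_lt.2 h)
    · exact absurd hj'.2 (not_lt.2 h)
  refine ⟨⟨j, hjN⟩, ?_⟩
  change ∃ E : Set (Y → ℝ), MeasurableSet E ∧ 1 / 36 ≤ (cubeMeasure Y).real E ∧
      ∀ u ∈ E, dist x y / 64 ≤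
        |amplitude B x * cutoff (4 * B) u x - amplitude B y * cutoff (4 * B) u y|
  rcases hj with h | h
  · exact exists_separating_event hB hxy hfine h hj'.1.le hj'.2.le
  · rw [dist_comm] at hfine h hj'
    obtain ⟨E, hE, hμ, hu⟩ := exists_separating_event hB hxy.symm hfine h hj'.2.le hj'.1.le
    refine ⟨E, hE, hμ, fun u hu' => ?_⟩
    rw [dist_comm, abs_sub_comm]
    exact hu u hu'

lemma sum_growth_le {b : ℝ} (hb : 0 ≤ b) (N : ℕ) (x : Y) :
    ∑ j : Fin N, growth (b * 2 ^ (j : ℕ)) x ≤ Real.log (Fintype.card Y) := by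
  rw [Fin.sum_univ_eq_sum_range (fun j => growth (b * 2 ^ j) x)]
  have h : ∀ j, growth (b * 2 ^ j) x =
      Real.log (softVol (b * 2 ^ j) x) - Real.log (softVol (b * 2 ^ (j + 1)) x) := fun j => by
    rw [growth, show 2 * (b * 2 ^ j) = b * 2 ^ (j + 1) by ring]
  simp_rw [h]
  rw [Finset.sum_range_sub' fun j => Real.log (softVol (b * 2 ^ j) x)]
  have h1 := log_softVol_le (by positivity : 0 ≤ b * 2 ^ 0) x
  have h2 := log_softVol_nonneg (b * 2 ^ N) x
  linarith

variable (Y) in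
lemma exists_scale_range : ∃ b : ℝ, 0 < b ∧ ∃ N : ℕ, ∀ x y : Y, x ≠ y →
    2 * b * dist x y ≤ 1 ∧
      Real.log (Fintype.card Y) < 2 * (b * 2 ^ N) * dist x y / 32 := by
  obtain ⟨R, hR⟩ := (Set.finite_range fun p : Y × Y => dist p.1 p.2).bddAbove
  obtain ⟨S, hS⟩ := (Set.finite_range fun p : Y × Y => (dist p.1 p.2)⁻¹).bddAbove
  have hb : 0 < 1 / (2 * (|R| + 1)) := by positivity
  obtain ⟨N, hN⟩ := pow_unbounded_of_one_lt
    (16 * Real.log (Fintype.card Y) * S / (1 / (2 * (|R| + 1)))) one_lt_two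
  refine ⟨1 / (2 * (|R| + 1)), hb, N, fun x y hxy => ?_⟩
  have hd : 0 < dist x y := dist_pos.2 hxy
  have h1 : dist x y ≤ R := hR ⟨(x, y), rfl⟩
  have h2 : (dist x y)⁻¹ ≤ S := hS ⟨(x, y), rfl⟩
  have hlog : 0 ≤ Real.log (Fintype.card Y) := Real.log_natCast_nonneg _
  constructor
  · have : 2 * (1 / (2 * (|R| + 1))) * dist x y = dist x y / (|R| + 1) := by field_simp
    rw [this, div_le_one (by positivity)]
    linarith [le_abs_self R]
  · set b := 1 / (2 * (|R| + 1))
    rw [div_lt_iff₀ hb] at hN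
    have h3 : 16 * Real.log (Fintype.card Y) * (dist x y)⁻¹ < b * 2 ^ N := by
      calc _ ≤ 16 * Real.log (Fintype.card Y) * S := by gcongr
        _ < _ := by linarith
    have h4 := mul_lt_mul_of_pos_right h3 hd
    rw [mul_assoc, inv_mul_cancel₀ hd.ne'] at h4
    linarith

open Classical in
/-- For every weighting of the pairs, some Lipschitz function expands a constant fraction. -/
lemma exists_lipschitz_expanding (w : {p : Y × Y // p.1 ≠ p.2} → ℝ) (hw : ∀ i, 0 ≤ w i) :
    ∃ f : {f : Y → ℝ // ∀ x y, |f x - f y| ≤ 388 * Real.log (Fintype.card Y) * dist x y},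
      1 / 72 * ∑ i, w i ≤
        ∑ i with dist i.1.1 i.1.2 / 64 ≤ |f.1 i.1.1 - f.1 i.1.2|, w i := by
  obtain ⟨b, hb, N, hbN⟩ := exists_scale_range Y
  have hcrit := fun i : {p : Y × Y // p.1 ≠ p.2} =>
    exists_critical_scale hb N i.2 (hbN _ _ i.2).1 (hbN _ _ i.2).2
  choose j E hE hμ hsep using hcrit
  obtain ⟨u, hu⟩ := exists_weight_le_of_le_measureReal (cubeMeasure Y) E hE hμ w hw
  let g : Fin N → Y → ℝ := fun k x =>
    amplitude (b * 2 ^ (k : ℕ)) x * cutoff (4 * (b * 2 ^ (k : ℕ))) u x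
  obtain ⟨ε, hε, hsum⟩ := exists_signs (Finset.univ.filter fun i => u ∈ E i) w hw
    (fun i k => g k i.1.1 - g k i.1.2) j
  refine ⟨⟨fun x => ∑ k, ε k * g k x, fun x y => ?_⟩, ?_⟩
  · rw [← Finset.sum_sub_distrib]
    calc _ ≤ ∑ k, |ε k * g k x - ε k * g k y| := Finset.abs_sum_le_sum_abs _ _
      _ ≤ ∑ k : Fin N, (196 * growth (b * 2 ^ (k : ℕ)) x +
            192 * growth (b * 2 ^ (k : ℕ)) y) * dist x y := by
          refine Finset.sum_le_sum fun k _ => ?_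
          rw [← mul_sub, abs_mul, hε, one_mul]
          exact abs_scale_sub_le (by positivity) u x y
      _ = (196 * ∑ k : Fin N, growth (b * 2 ^ (k : ℕ)) x +
            192 * ∑ k : Fin N, growth (b * 2 ^ (k : ℕ)) y) * dist x y := by
          rw [← Finset.sum_mul, Finset.sum_add_distrib, Finset.mul_sum, Finset.mul_sum]
      _ ≤ _ := by
          gcongr
          linarith [sum_growth_le hb.le N x, sum_growth_le hb.le N y]
  · calc 1 / 72 * ∑ i, w i ≤ (∑ i with u ∈ E i, w i) / 2 := by linarith
      _ ≤ _ := hsum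
      _ ≤ _ := by
          refine Finset.sum_le_sum_of_subset_of_nonneg (fun i hi => ?_) fun i _ _ => hw i
          simp only [Finset.mem_filter, Finset.mem_univ, true_and] at hi ⊢
          rw [← Finset.sum_sub_distrib]
          simp_rw [← mul_sub]
          exact (hsep i u hi.1).trans hi.2

open Classical in
lemma exists_coordinates (D : ℕ) (hD : 576 * Real.log (Fintype.card Y) ≤ D) :
    ∃ f : Fin D → Y → ℝ,
      (∀ t x y, |f t x - f t y| ≤ 388 * Real.log (Fintype.card Y) * dist x y) ∧
      ∀ x y, x ≠ y → (D : ℝ) / 288 ≤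
        (Finset.univ.filter fun t => dist x y / 64 ≤ |f t x - f t y|).card := by
  obtain ⟨f, hf⟩ := exists_sequence_of_weighted
    (fun (f : {f : Y → ℝ // ∀ x y, |f x - f y| ≤ 388 * Real.log (Fintype.card Y) * dist x y})
      (i : {p : Y × Y // p.1 ≠ p.2}) => dist i.1.1 i.1.2 / 64 ≤ |f.1 i.1.1 - f.1 i.1.2|)
    (by norm_num : (1 / 72 : ℝ) ≤ 2) exists_lipschitz_expanding D
  refine ⟨fun t => (f t).1, fun t => (f t).2, fun x y hxy => ?_⟩
  set c := (Finset.univ.filter fun t => dist x y / 64 ≤ |(f t).1 x - (f t).1 y|).card with hc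
  have h1 : (1 / 2 : ℝ) ^ c ≤
      (1 - 1 / 72 / 2) ^ D * Fintype.card {p : Y × Y // p.1 ≠ p.2} :=
    le_trans (Finset.single_le_sum (f := fun i : {p : Y × Y // p.1 ≠ p.2} => (1 / 2 : ℝ) ^
      (Finset.univ.filter fun t => dist i.1.1 i.1.2 / 64 ≤ |(f t).1 i.1.1 - (f t).1 i.1.2|).card)
      (fun i _ => by positivity) (Finset.mem_univ ⟨(x, y), hxy⟩)) hf
  have hn : (0 : ℝ) < Fintype.card Y := by
    have : Nonempty Y := ⟨x⟩
    exact_mod_cast Fintype.card_pos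
  have hcard : (Fintype.card {p : Y × Y // p.1 ≠ p.2} : ℝ) ≤
      Real.exp (2 * Real.log (Fintype.card Y)) := by
    have h2 : Fintype.card {p : Y × Y // p.1 ≠ p.2} ≤ Fintype.card Y * Fintype.card Y :=
      (Fintype.card_subtype_le _).trans_eq (Fintype.card_prod _ _)
    rw [two_mul, Real.exp_add, Real.exp_log hn]
    exact_mod_cast h2
  have hbase : (1 - 1 / 72 / 2 : ℝ) ^ D ≤ Real.exp (-(D / 144)) := by
    have h3 : (1 - 1 / 72 / 2 : ℝ) ≤ Real.exp (-(1 / 144)) := by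
      linarith [Real.add_one_le_exp (-(1 / 144 : ℝ))]
    calc _ ≤ Real.exp (-(1 / 144)) ^ D := pow_le_pow_left₀ (by norm_num) h3 D
      _ = _ := by rw [← Real.exp_nat_mul]; congr 1; ring
  have hhalf : Real.exp (-c) ≤ (1 / 2 : ℝ) ^ c := by
    have h4 : Real.exp (-1) ≤ 1 / 2 := by linarith [Real.exp_neg_one_lt_half]
    calc Real.exp (-c) = Real.exp (-1) ^ c := by rw [← Real.exp_nat_mul]; congr 1; ring
      _ ≤ _ := pow_le_pow_left₀ (Real.exp_pos _).le h4 c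
  have hfin : Real.exp (-c) ≤ Real.exp (-(D / 144) + 2 * Real.log (Fintype.card Y)) := by
    rw [Real.exp_add]
    exact hhalf.trans (h1.trans (by gcongr))
  have := Real.exp_le_exp.1 hfin
  linarith

end RandomMap

lemma lpNorm_le {m : ℕ} {p M : ℝ} (hp : 0 < p) (hM : 0 ≤ M) {x : Fin m → ℝ}
    (h : ∑ i, |x i| ^ p ≤ M ^ p) : lpNorm p x ≤ M := by
  calc lpNorm p x ≤ (M ^ p) ^ (1 / p) := by unfold lpNorm; gcongr
    _ = M := by rw [one_div, Real.rpow_rpow_inv hM hp.ne']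

lemma le_lpNorm {m : ℕ} {p M : ℝ} (hp : 0 < p) (hM : 0 ≤ M) {x : Fin m → ℝ}
    (h : M ^ p ≤ ∑ i, |x i| ^ p) : M ≤ lpNorm p x := by
  calc M = (M ^ p) ^ (1 / p) := by rw [one_div, Real.rpow_rpow_inv hM hp.ne']
    _ ≤ lpNorm p x := by unfold lpNorm; gcongr

/-- Every finite metric space with a set `K` of `k ≥ 2` terminals embeds into
`ℓ_p^{O(log k)}` with terminal distortion `O(log k)`. -/
theorem terminal_embedding_log_k :
    ∃ C : ℝ, 0 < C ∧
      ∀ (X : Type) [MetricSpace X] [Fintype X] (K : Finset X) (p : ℝ),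
        2 ≤ K.card → 1 ≤ p →
        ∃ (m : ℕ) (F : X → Fin m → ℝ) (c : ℝ),
          (m : ℝ) ≤ C * Real.log K.card ∧ 0 < c ∧
          ∀ v ∈ K, ∀ u : X,
            dist v u ≤ c * lpNorm p (F v - F u) ∧
            c * lpNorm p (F v - F u) ≤ C * Real.log K.card * dist v u := by
  classical
  refine ⟨28608016, by norm_num, fun X _ _ K p hK hp => ?_⟩
  have hp0 : 0 < p := zero_lt_one.trans_le hp
  set l := Real.log K.card with hl
  have hl2 : 1 / 2 ≤ l := by
    have h1 : Real.log 2 ≤ l := Real.log_le_log (by norm_num) (by exact_mod_cast hK)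
    linarith [Real.log_two_gt_d9]
  set D := ⌈576 * l⌉₊ with hD
  have hDge : 576 * l ≤ D := Nat.le_ceil _
  have hDlt : (D : ℝ) < 576 * l + 1 := Nat.ceil_lt_add_one (by positivity)
  have hD0 : (0 : ℝ) < D := by linarith
  have hcard : Fintype.card K = K.card := Fintype.card_coe K
  obtain ⟨f, hlip, hexp⟩ := exists_coordinates (Y := K) D (by rw [hcard]; exact hDge)
  rw [hcard] at hlip
  have hKne : K.Nonempty := Finset.card_pos.1 (by omega)
  have hnear : ∀ u : X, ∃ t : K, ∀ v ∈ K, dist u t ≤ dist u v := fun u => by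
    obtain ⟨t, ht, h⟩ := K.exists_min_image (fun v => dist u v) hKne
    exact ⟨⟨t, ht⟩, h⟩
  choose t ht using hnear
  set s : ℝ := (D : ℝ) ^ (1 / p) with hs
  have hs0 : 0 < s := Real.rpow_pos_of_pos hD0 _
  have hsp : s ^ p = D := by rw [hs, one_div, Real.rpow_inv_rpow hD0.le hp0.ne']
  refine ⟨D + 1, fun u => Fin.cons (s * dist u (t u)) fun i => f i (t u), 18433 / s, ?_,
    by positivity, fun v hv u => ?_⟩
  · push_cast
    linarith
  have htv : t v = ⟨v, hv⟩ := by
    have h := ht v v hv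
    rw [dist_self] at h
    exact Subtype.ext (dist_le_zero.1 h).symm
  set r := dist v u with hr
  set δ := dist u (t u) with hδ
  have hr0 : 0 ≤ r := dist_nonneg
  have hδ0 : 0 ≤ δ := dist_nonneg
  have hδr : δ ≤ r := (ht u v hv).trans_eq (dist_comm u v)
  have htri : dist v (t u) ≤ r + δ := dist_triangle _ _ _
  have htri' : r ≤ dist v (t u) + δ := by
    rw [hδ, dist_comm u]
    exact dist_triangle _ _ _
  set w : Fin (D + 1) → ℝ := (fun u => Fin.cons (s * dist u (t u)) fun i => f i (t u) :
      X → Fin (D + 1) → ℝ) v - (fun u => Fin.cons (s * dist u (t u)) fun i => f i (t u) :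
      X → Fin (D + 1) → ℝ) u with hw
  have hw0 : |w 0| = s * δ := by
    simp only [hw, Pi.sub_apply, Fin.cons_zero, htv, dist_self, mul_zero, zero_sub, abs_neg]
    exact abs_of_nonneg (by positivity)
  have hws : ∀ i : Fin D, |w i.succ| = |f i ⟨v, hv⟩ - f i (t u)| := fun i => by
    simp only [hw, Pi.sub_apply, Fin.cons_succ, htv]
  have hsum : ∑ i, |w i| ^ p = D * δ ^ p + ∑ i : Fin D, |f i ⟨v, hv⟩ - f i (t u)| ^ p := by
    rw [Fin.sum_univ_succ, hw0, Real.mul_rpow hs0.le hδ0, hsp]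
    simp_rw [hws]
  have hnn : 0 ≤ ∑ i : Fin D, |f i ⟨v, hv⟩ - f i (t u)| ^ p :=
    Finset.sum_nonneg fun i _ => by positivity
  constructor
  · have hlow1 : s * δ ≤ lpNorm p w := by
      refine le_lpNorm hp0 (by positivity) ?_
      rw [hsum, Real.mul_rpow hs0.le hδ0, hsp]
      linarith
    have hlow2 : s * (dist v (t u) / 18432) ≤ lpNorm p w := by
      by_cases hvt : (⟨v, hv⟩ : K) = t u
      · rw [← hvt, dist_self, zero_div, mul_zero]
        exact (by positivity : 0 ≤ s * δ).trans hlow1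
      refine le_lpNorm hp0 (by positivity) ?_
      rw [hsum, Real.mul_rpow hs0.le (by positivity), hsp]
      have hgood := hexp _ _ hvt
      have hdist : dist (⟨v, hv⟩ : K) (t u) = dist v (t u) := rfl
      rw [hdist] at hgood
      set G := Finset.univ.filter
        fun i => dist v (t u) / 64 ≤ |f i ⟨v, hv⟩ - f i (t u)| with hG
      have h1 : (G.card : ℝ) * (dist v (t u) / 64) ^ p ≤
          ∑ i : Fin D, |f i ⟨v, hv⟩ - f i (t u)| ^ p := by
        calc _ = ∑ i ∈ G, (dist v (t u) / 64) ^ p := by rw [Finset.sum_const, nsmul_eq_mul]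
          _ ≤ ∑ i ∈ G, |f i ⟨v, hv⟩ - f i (t u)| ^ p := by
              refine Finset.sum_le_sum fun i hi => ?_
              have := (Finset.mem_filter.1 hi).2
              gcongr
          _ ≤ _ := Finset.sum_le_sum_of_subset_of_nonneg (Finset.subset_univ _)
              fun i _ _ => by positivity
      have h2 : (dist v (t u) / 18432) ^ p ≤ 1 / 288 * (dist v (t u) / 64) ^ p := by
        rw [show dist v (t u) / 18432 = 1 / 288 * (dist v (t u) / 64) by ring,
          Real.mul_rpow (by norm_num) (by positivity)]
        gcongr
        exact Real.rpow_le_self_of_le_one (by norm_num) (by norm_num) hp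
      calc D * (dist v (t u) / 18432) ^ p ≤ D * (1 / 288 * (dist v (t u) / 64) ^ p) := by gcongr
        _ = D / 288 * (dist v (t u) / 64) ^ p := by ring
        _ ≤ G.card * (dist v (t u) / 64) ^ p := by gcongr
        _ ≤ D * δ ^ p + _ := h1.trans (le_add_of_nonneg_left (by positivity))
    rw [div_mul_eq_mul_div, le_div_iff₀ hs0]
    nlinarith
  · have hup : lpNorm p w ≤ 2 * s * (776 * l * r) := by
      refine lpNorm_le hp0 (by positivity) ?_
      rw [hsum, Real.mul_rpow (by positivity) (by positivity), Real.mul_rpow (by norm_num) hs0.le,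
        hsp]
      have h1 : δ ^ p ≤ (776 * l * r) ^ p := by
        gcongr
        nlinarith
      have h2 : ∑ i : Fin D, |f i ⟨v, hv⟩ - f i (t u)| ^ p ≤ D * (776 * l * r) ^ p := by
        calc _ ≤ ∑ i : Fin D, (776 * l * r) ^ p := by
              refine Finset.sum_le_sum fun i _ => ?_
              gcongr
              refine (hlip i ⟨v, hv⟩ (t u)).trans ?_
              change 388 * l * dist v (t u) ≤ _
              nlinarith
          _ = _ := by simp
      have h3 : (2 : ℝ) ≤ 2 ^ p := Real.self_le_rpow_of_one_le (by norm_num) hp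
      calc _ ≤ D * (776 * l * r) ^ p + D * (776 * l * r) ^ p := by gcongr
        _ = 2 * D * (776 * l * r) ^ p := by ring
        _ ≤ _ := by gcongr
    calc 18433 / s * lpNorm p w ≤ 18433 / s * (2 * s * (776 * l * r)) := by gcongr
      _ = _ := by field_simp; ring
end

section
/- There exists a universal constant C > 0 such that for every finite metric space (X,d) with |X| = n, every set of terminals K ⊆ X with |K| = k ≥ 2, and every integer t ≥ 1, there exists a set E of unordered pairs of distinct points of X with |E| ≤ C·k^{1+1/t} + n such that for every v ∈ K and u ∈ X there exists a finite sequence v = x₀, x₁, …, x_m = u with {x_i, x_{i+1}} ∈ E for every 0 ≤ i < m and Σ_{i=0}^{m−1} d(x_i, x_{i+1}) ≤ (4t−1)·d(v,u). -/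
namespace SimpleGraph

/-- Every walk joining the endpoints of an edge of `G` while avoiding that edge has length at
least `L`; equivalently, `G` has no cycle of length at most `L`. -/
def DetourAtLeast {V : Type*} (G : SimpleGraph V) (L : ℕ) : Prop :=
  ∀ ⦃a b : V⦄, G.Adj a b → ∀ w : G.Walk a b, s(a, b) ∉ w.edges → L ≤ w.length

lemma DetourAtLeast.mono {V : Type*} {G H : SimpleGraph V} {L : ℕ} (hG : G.DetourAtLeast L)
    (h : H ≤ G) : H.DetourAtLeast L := by
  intro a b hab w hw
  have := hG (h hab) (w.mapLe h) (by simpa using hw)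
  simpa using this

lemma Walk.IsTrail.exists_split_of_mem_edges {V : Type*} {G : SimpleGraph V} {a b p q : V}
    {w : G.Walk a b} (hw : w.IsTrail) (he : s(p, q) ∈ w.edges) :
    (∃ (w₁ : G.Walk a p) (w₂ : G.Walk q b), w₁.length + w₂.length + 1 = w.length ∧
      s(p, q) ∉ w₁.edges ∧ s(p, q) ∉ w₂.edges) ∨
    (∃ (w₁ : G.Walk a q) (w₂ : G.Walk p b), w₁.length + w₂.length + 1 = w.length ∧
      s(p, q) ∉ w₁.edges ∧ s(p, q) ∉ w₂.edges) := by
  induction w with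
  | nil => simp at he
  | @cons a c b h w' ih =>
    rw [Walk.isTrail_cons] at hw
    by_cases hpq : s(p, q) = s(a, c)
    · have hn : s(p, q) ∉ w'.edges := hpq ▸ hw.2
      rcases Sym2.eq_iff.mp hpq with ⟨rfl, rfl⟩ | ⟨rfl, rfl⟩
      · exact Or.inl ⟨Walk.nil, w', by simp, by simp, hn⟩
      · exact Or.inr ⟨Walk.nil, w', by simp, by simp, hn⟩
    · have he' : s(p, q) ∈ w'.edges := by
        simpa [hpq] using he
      rcases ih hw.1 he' with ⟨w₁, w₂, hl, h₁, h₂⟩ | ⟨w₁, w₂, hl, h₁, h₂⟩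
      · exact Or.inl ⟨Walk.cons h w₁, w₂, by simp; omega, by simp [hpq, h₁], h₂⟩
      · exact Or.inr ⟨Walk.cons h w₁, w₂, by simp; omega, by simp [hpq, h₁], h₂⟩

lemma exists_walk_of_notMem_edges_sup_edge {V : Type*} {G : SimpleGraph V} {p q a b : V}
    (w : (G ⊔ edge p q).Walk a b) (hw : s(p, q) ∉ w.edges) :
    ∃ w' : G.Walk a b, w'.edges = w.edges ∧ w'.length = w.length := by
  have h : ∀ e ∈ w.edges, e ∈ G.edgeSet := by
    intro e he
    induction e with
    | _ x y =>
      have hxy := w.adj_of_mem_edges he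
      rw [sup_adj, edge_adj] at hxy
      rcases hxy with hxy | ⟨⟨rfl, rfl⟩ | ⟨rfl, rfl⟩, -⟩
      · exact hxy
      · exact absurd he hw
      · exact absurd (Sym2.eq_swap ▸ he) hw
  exact ⟨w.transfer G h, w.edges_transfer h, w.length_transfer h⟩

lemma DetourAtLeast.sup_edge {V : Type*} {G : SimpleGraph V} {L : ℕ} {p q : V}
    (hG : G.DetourAtLeast L) (h : ∀ w : G.Walk p q, L ≤ w.length) :
    (G ⊔ edge p q).DetourAtLeast L := by
  classical
  intro a b hab w hw
  by_cases hpq : s(p, q) = s(a, b)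
  · obtain ⟨w', -, hl⟩ := exists_walk_of_notMem_edges_sup_edge w (hpq ▸ hw)
    rw [← hl]
    rcases Sym2.eq_iff.mp hpq with ⟨rfl, rfl⟩ | ⟨rfl, rfl⟩
    · exact h w'
    · simpa using h w'.reverse
  · have hab' : G.Adj a b := by
      rw [sup_adj, edge_adj] at hab
      rcases hab with hab | ⟨⟨rfl, rfl⟩ | ⟨rfl, rfl⟩, -⟩
      · exact hab
      · exact absurd rfl hpq
      · exact absurd Sym2.eq_swap hpq
    refine le_trans ?_ w.length_bypass_le_length
    have hwb : s(a, b) ∉ w.bypass.edges := fun h' => hw (w.edges_bypass_subset_edges h')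
    by_cases he : s(p, q) ∈ w.bypass.edges
    · rcases w.bypass_isPath.isTrail.exists_split_of_mem_edges he with
        ⟨w₁, w₂, hl, h₁, h₂⟩ | ⟨w₁, w₂, hl, h₁, h₂⟩
      all_goals
        obtain ⟨w₁', -, hl₁⟩ := exists_walk_of_notMem_edges_sup_edge w₁ h₁
        obtain ⟨w₂', -, hl₂⟩ := exists_walk_of_notMem_edges_sup_edge w₂ h₂
      · have := h (w₁'.reverse.append (Walk.cons hab' w₂'.reverse))
        simp only [Walk.length_append, Walk.length_reverse, Walk.length_cons] at this
        omega
      · have := h (w₂'.append (Walk.cons hab'.symm w₁'))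
        simp only [Walk.length_append, Walk.length_cons] at this
        omega
    · obtain ⟨w', he', hl⟩ := exists_walk_of_notMem_edges_sup_edge w.bypass he
      rw [← hl]
      exact hG hab' w' (he' ▸ hwb)

lemma notMem_support_of_length_eq_dist {V : Type*} {G : SimpleGraph V} {v w x : V}
    (hx : x ≠ w) (hd : G.dist v x ≤ G.dist v w) {P : G.Walk v x} (hP : P.length = G.dist v x) :
    w ∉ P.support := by
  classical
  intro hw
  have h₁ := Walk.length_takeUntil_lt_length hw hx.symm
  have h₂ := dist_le (P.takeUntil w hw)
  omega

lemma DetourAtLeast.le_dist_add_dist {V : Type*} {G : SimpleGraph V} {L : ℕ} {v w x y : V}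
    (hG : G.DetourAtLeast L) (hvw : G.Reachable v w) (hxw : G.Adj w x) (hyw : G.Adj w y)
    (hxy : x ≠ y) (hdx : G.dist v x ≤ G.dist v w) (hdy : G.dist v y ≤ G.dist v w) :
    L ≤ G.dist v x + G.dist v y + 1 := by
  obtain ⟨P, hP⟩ := (hvw.trans hxw.reachable).exists_walk_length_eq_dist
  obtain ⟨Q, hQ⟩ := (hvw.trans hyw.reachable).exists_walk_length_eq_dist
  have hPw := notMem_support_of_length_eq_dist hxw.ne' hdx hP
  have hQw := notMem_support_of_length_eq_dist hyw.ne' hdy hQ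
  have := hG hxw (Walk.cons hyw (Q.reverse.append P)) (by
    simp only [Walk.edges_cons, Walk.edges_append, Walk.edges_reverse, List.mem_cons,
      List.mem_append, List.mem_reverse, not_or]
    refine ⟨by simpa using ⟨hxy, fun h => absurd h hyw.ne⟩, fun h => hQw ?_, fun h => hPw ?_⟩
    · exact Q.fst_mem_support_of_mem_edges h
    · exact P.fst_mem_support_of_mem_edges h)
  simp only [Walk.length_append, Walk.length_reverse, Walk.length_cons] at this
  omega

open Classical in
/-- Moore bound: the sphere of radius `i ≤ t` has at least `D ^ i` points. -/
lemma DetourAtLeast.pow_le_card_sphere {V : Type*} [Fintype V] {G : SimpleGraph V} {t D : ℕ}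
    (hG : G.DetourAtLeast (2 * t)) (v : V) (hdeg : ∀ w, G.Reachable v w → D + 1 ≤ G.degree w)
    {i : ℕ} (hi : i ≤ t) :
    D ^ i ≤ (Finset.univ.filter fun w => G.Reachable v w ∧ G.dist v w = i).card := by
  induction i with
  | zero =>
    rw [pow_zero, Nat.one_le_iff_ne_zero, Finset.card_ne_zero]
    exact ⟨v, by simp⟩
  | succ i ih =>
    rw [pow_succ]
    refine (Nat.mul_le_mul_right D (ih (by omega))).trans ?_
    rw [← mul_one (Finset.card (Finset.univ.filter fun w => G.Reachable v w ∧ G.dist v w = i + 1))]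
    refine Finset.card_mul_le_card_mul G.Adj ?_ ?_
    · intro w hw
      simp only [Finset.mem_filter, Finset.mem_univ, true_and] at hw
      have hone : ((G.neighborFinset w).filter fun x => G.dist v x ≤ i).card ≤ 1 := by
        refine Finset.card_le_one.mpr fun x hx y hy => ?_
        simp only [Finset.mem_filter, mem_neighborFinset] at hx hy
        by_contra hxy
        have := hG.le_dist_add_dist hw.1 hx.1 hy.1 hxy (by omega) (by omega)
        omega
      have hsub : ((G.neighborFinset w).filter fun x => ¬ G.dist v x ≤ i) ⊆
          Finset.bipartiteAbove G.Adj
            (Finset.univ.filter fun w => G.Reachable v w ∧ G.dist v w = i + 1) w := by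
        intro x hx
        simp only [Finset.mem_filter, mem_neighborFinset, Finset.mem_bipartiteAbove,
          Finset.mem_univ, true_and] at hx ⊢
        obtain ⟨P, hP⟩ := hw.1.exists_walk_length_eq_dist
        have := dist_le (P.concat hx.1)
        rw [Walk.length_concat] at this
        exact ⟨⟨hw.1.trans hx.1.reachable, by omega⟩, hx.1⟩
      have hcard := Finset.card_filter_add_card_filter_not (s := G.neighborFinset w)
        (fun x => G.dist v x ≤ i)
      rw [card_neighborFinset_eq_degree] at hcard
      have := Finset.card_le_card hsub
      have := hdeg w hw.1
      omega
    · intro w hw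
      simp only [Finset.mem_filter, Finset.mem_univ, true_and] at hw
      refine Finset.card_le_one.mpr fun x hx y hy => ?_
      simp only [Finset.mem_filter, Finset.mem_bipartiteBelow, Finset.mem_univ, true_and] at hx hy
      by_contra hxy
      have := hG.le_dist_add_dist hw.1 hx.2.symm hy.2.symm hxy (by omega) (by omega)
      omega

open Classical in
lemma DetourAtLeast.card_edgeFinset_le {V : Type*} [Fintype V] {t D k : ℕ} (ht : 1 ≤ t)
    (hk : k ≤ D ^ t) (S : Finset V) (hS : S.card ≤ k) (G : SimpleGraph V)
    (hG : G.DetourAtLeast (2 * t)) (hGS : ∀ a b, G.Adj a b → a ∈ S) :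
    G.edgeFinset.card ≤ D * S.card := by
  induction S using Finset.strongInduction generalizing G with
  | H S ih =>
    rcases S.eq_empty_or_nonempty with rfl | ⟨v, hv⟩
    · have : G = ⊥ := by
        ext a b
        simpa using fun h => hGS a b h
      subst this
      simp
    by_cases hdeg : ∀ w ∈ S, D + 1 ≤ G.degree w
    · exfalso
      have hreach : ∀ w, G.Reachable v w → w ∈ S := by
        rintro w ⟨P⟩
        cases P.reverse with
        | nil => exact hv
        | cons h _ => exact hGS _ _ h
      have hpow := hG.pow_le_card_sphere v (fun w hw => hdeg w (hreach w hw)) le_rfl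
      have hsub : (Finset.univ.filter fun w => G.Reachable v w ∧ G.dist v w = t) ⊆ S.erase v := by
        intro w hw
        simp only [Finset.mem_filter, Finset.mem_univ, true_and] at hw
        refine Finset.mem_erase.mpr ⟨?_, hreach w hw.1⟩
        rintro rfl
        have := hw.2
        rw [dist_self] at this
        omega
      have := Finset.card_le_card hsub
      have := Finset.card_erase_lt_of_mem hv
      omega
    · push Not at hdeg
      obtain ⟨x, hx, hdx⟩ := hdeg
      have h := ih (S.erase x) (Finset.erase_ssubset hx)
        ((Finset.card_le_card (Finset.erase_subset _ _)).trans hS) (G.deleteIncidenceSet x)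
        (hG.mono (G.deleteIncidenceSet_le x)) (fun a b hab => by
          rw [deleteIncidenceSet_adj] at hab
          exact Finset.mem_erase.mpr ⟨hab.2.1, hGS a b hab.1⟩)
      have hdel : G.edgeFinset.card - G.degree x ≤ D * (S.erase x).card := by
        rw [← G.card_edgeFinset_deleteIncidenceSet x]
        convert h
      have hS' := Finset.card_erase_add_one hx
      rw [← hS', mul_add, mul_one]
      omega

/-- The total metric length of a walk. -/
def Walk.metricLength {V : Type*} [Dist V] {G : SimpleGraph V} {a b : V} : G.Walk a b → ℝ
  | .nil => 0
  | .cons (u := u) (v := v) _ w => Dist.dist u v + w.metricLength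

lemma Walk.metricLength_le {V : Type*} [Dist V] {G : SimpleGraph V} {M : ℝ}
    (hM : ∀ a b, G.Adj a b → Dist.dist a b ≤ M) {a b : V} (w : G.Walk a b) :
    w.metricLength ≤ w.length * M := by
  induction w with
  | nil => simp [metricLength]
  | cons h w ih =>
    have := hM _ _ h
    simp only [metricLength, length_cons, Nat.cast_add, Nat.cast_one]
    linarith

lemma Walk.metricLength_mapLe {V : Type*} [Dist V] {G H : SimpleGraph V} (hGH : G ≤ H)
    {a b : V} (w : G.Walk a b) : (w.mapLe hGH).metricLength = w.metricLength := by
  induction w with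
  | nil => rfl
  | cons h w ih => exact congrArg _ ih

lemma Walk.metricLength_concat {V : Type*} [Dist V] {G : SimpleGraph V} {a b c : V}
    (w : G.Walk a b) (h : G.Adj b c) :
    (w.concat h).metricLength = w.metricLength + Dist.dist b c := by
  induction w with
  | nil => simp [metricLength, concat_nil]
  | cons h' w ih => rw [concat_cons, metricLength, metricLength, ih, add_assoc]

lemma Walk.sum_dist_getVert {V : Type*} [Dist V] {G : SimpleGraph V} {a b : V}
    (w : G.Walk a b) :
    ∑ i : Fin w.length, Dist.dist (w.getVert i) (w.getVert (i + 1)) = w.metricLength := by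
  induction w with
  | nil => exact Fin.sum_univ_zero _
  | cons h w ih =>
    rw [metricLength, ← ih]
    exact (Fin.sum_univ_succ _).trans (by simp)

/-- The greedy spanner on a finite set `S` of pairs of points. -/
lemma exists_detourAtLeast_spanner {X : Type*} [MetricSpace X] {t : ℕ} (ht : 1 ≤ t)
    (S : Finset (X × X)) :
    ∃ G : SimpleGraph X, G.DetourAtLeast (2 * t) ∧
      (∀ a b, G.Adj a b → (a, b) ∈ S ∨ (b, a) ∈ S) ∧
      ∀ e ∈ S, ∃ w : G.Walk e.1 e.2, w.metricLength ≤ (2 * (t : ℝ) - 1) * Dist.dist e.1 e.2 := by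
  classical
  have ht' : (1 : ℝ) ≤ t := by exact_mod_cast ht
  induction S using Finset.induction_on_max_value (fun e : X × X => Dist.dist e.1 e.2) with
  | empty => exact ⟨⊥, fun a b h => absurd h (by simp), by simp, by simp⟩
  | insert e S _ hmax ih =>
    obtain ⟨p, q⟩ := e
    obtain ⟨G, hG, hGS, hspan⟩ := ih
    by_cases hw : ∃ w : G.Walk p q, w.metricLength ≤ (2 * (t : ℝ) - 1) * Dist.dist p q
    · refine ⟨G, hG, fun a b h => ?_, ?_⟩
      · exact (hGS a b h).imp (Finset.mem_insert_of_mem) (Finset.mem_insert_of_mem)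
      · intro e he
        rcases Finset.mem_insert.mp he with rfl | he
        · exact hw
        · exact hspan e he
    push Not at hw
    have hpq : p ≠ q := by
      rintro rfl
      have := hw Walk.nil
      simp [Walk.metricLength] at this
    have hpos : 0 < Dist.dist p q := dist_pos.mpr hpq
    have hGM : ∀ a b, G.Adj a b → Dist.dist a b ≤ Dist.dist p q := by
      intro a b hab
      rcases hGS a b hab with h | h
      · exact hmax _ h
      · rw [_root_.dist_comm a b]
        exact hmax _ h
    have hlen : ∀ w : G.Walk p q, 2 * t ≤ w.length := by
      intro w
      have h₁ := (hw w).trans_le (w.metricLength_le hGM)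
      have h₂ := lt_of_mul_lt_mul_right h₁ hpos.le
      have h₃ : 2 * t < w.length + 1 := by
        have : (2 * (t : ℝ)) < w.length + 1 := by linarith
        exact_mod_cast this
      omega
    refine ⟨G ⊔ edge p q, hG.sup_edge hlen, fun a b hab => ?_, fun e he => ?_⟩
    · rw [sup_adj, edge_adj] at hab
      rcases hab with hab | ⟨⟨rfl, rfl⟩ | ⟨rfl, rfl⟩, -⟩
      · exact (hGS a b hab).imp (Finset.mem_insert_of_mem) (Finset.mem_insert_of_mem)
      · exact Or.inl (Finset.mem_insert_self _ _)
      · exact Or.inr (Finset.mem_insert_self _ _)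
    · rcases Finset.mem_insert.mp he with rfl | he
      · have hadj : (G ⊔ edge p q).Adj p q := by
          rw [sup_adj, edge_adj]
          exact Or.inr ⟨Or.inl ⟨rfl, rfl⟩, hpq⟩
        refine ⟨Walk.cons hadj Walk.nil, ?_⟩
        simp only [Walk.metricLength, add_zero]
        nlinarith
      · obtain ⟨w, hw⟩ := hspan e he
        exact ⟨w.mapLe le_sup_left, by rwa [Walk.metricLength_mapLe]⟩

end SimpleGraph

/-- The integer `⌈k ^ (1 / t)⌉` has `t`-th power at least `k`, and times `k` it is at most
`2 k ^ (1 + 1 / t)`. -/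
lemma exists_nat_pow_ge_mul_le {k t : ℕ} (hk : 1 ≤ k) (ht : 1 ≤ t) :
    ∃ D : ℕ, k ≤ D ^ t ∧ ((D * k : ℕ) : ℝ) ≤ 2 * (k : ℝ) ^ ((1 : ℝ) + 1 / (t : ℝ)) := by
  have hk' : (1 : ℝ) ≤ k := by exact_mod_cast hk
  have hr : (1 : ℝ) ≤ (k : ℝ) ^ (1 / (t : ℝ)) := Real.one_le_rpow hk' (by positivity)
  refine ⟨⌈(k : ℝ) ^ (1 / (t : ℝ))⌉₊, ?_, ?_⟩
  · have h₁ : ((k : ℝ) ^ (1 / (t : ℝ))) ^ t = k := by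
      rw [one_div, Real.rpow_inv_natCast_pow (by positivity) (by omega)]
    have h₂ : ((k : ℝ) ^ (1 / (t : ℝ))) ^ t ≤ (⌈(k : ℝ) ^ (1 / (t : ℝ))⌉₊ : ℝ) ^ t := by
      gcongr
      exact Nat.le_ceil _
    rw [h₁] at h₂
    exact_mod_cast h₂
  · have h := (Nat.ceil_lt_add_one (zero_le_one.trans hr)).le
    rw [Real.rpow_add (by positivity), Real.rpow_one]
    push_cast
    nlinarith

/-- Every finite metric space on `n` points with `k ≥ 2` terminals admits a
`(4t-1)`-terminal metric spanner with at most `C·k^{1+1/t} + n` edges. -/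
theorem terminal_metric_spanner :
    ∃ C : ℝ, 0 < C ∧
      ∀ (X : Type) [MetricSpace X] [Fintype X] (K : Finset X) (t : ℕ),
        2 ≤ K.card → 1 ≤ t →
        ∃ E : Finset (Sym2 X),
          (∀ e ∈ E, ¬ e.IsDiag) ∧
          (E.card : ℝ) ≤ C * (K.card : ℝ) ^ ((1 : ℝ) + 1 / (t : ℝ)) + Fintype.card X ∧
          ∀ v ∈ K, ∀ u : X,
            ∃ (m : ℕ) (x : Fin (m + 1) → X),
              x 0 = v ∧ x (Fin.last m) = u ∧
              (∀ i : Fin m, s(x i.castSucc, x i.succ) ∈ E) ∧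
              (∑ i : Fin m, dist (x i.castSucc) (x i.succ)) ≤
                (4 * (t : ℝ) - 1) * dist v u := by
  classical
  refine ⟨2, two_pos, fun X _ _ K t hK ht => ?_⟩
  have ht' : (1 : ℝ) ≤ t := by exact_mod_cast ht
  obtain ⟨G, hG, hGK, hspan⟩ := SimpleGraph.exists_detourAtLeast_spanner ht (K ×ˢ K)
  obtain ⟨D, hD, hDk⟩ := exists_nat_pow_ge_mul_le (k := K.card) (by omega) ht
  have hcard : G.edgeFinset.card ≤ D * K.card := by
    refine SimpleGraph.DetourAtLeast.card_edgeFinset_le ht hD K le_rfl G hG fun a b hab => ?_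
    rcases hGK a b hab with h | h
    · exact (Finset.mem_product.mp h).1
    · exact (Finset.mem_product.mp h).2
  have hne : K.Nonempty := Finset.card_pos.mp (by omega)
  choose π hπK hπ using fun u : X => K.exists_min_image (fun v => dist v u) hne
  let star := Finset.univ.image fun u : X => s(π u, u)
  let H := G ⊔ SimpleGraph.fromEdgeSet (star : Set (Sym2 X))
  have hwalk : ∀ v ∈ K, ∀ u, ∃ w : H.Walk v u,
      w.metricLength ≤ (4 * (t : ℝ) - 1) * dist v u := by
    intro v hv u
    by_cases hu : π u = u
    · obtain ⟨w, hw⟩ := hspan (v, u) (Finset.mem_product.mpr ⟨hv, hu ▸ hπK u⟩)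
      refine ⟨w.mapLe le_sup_left, ?_⟩
      rw [SimpleGraph.Walk.metricLength_mapLe]
      exact hw.trans (mul_le_mul_of_nonneg_right (by linarith) dist_nonneg)
    · obtain ⟨w, hw⟩ := hspan (v, π u) (Finset.mem_product.mpr ⟨hv, hπK u⟩)
      have hmin := hπ u v hv
      have htri := dist_triangle_right v (π u) u
      have hw' : w.metricLength + dist (π u) u ≤ (4 * (t : ℝ) - 1) * dist v u := by
        simp only at hw
        nlinarith
      have hadj : H.Adj (π u) u := by
        rw [SimpleGraph.sup_adj, SimpleGraph.fromEdgeSet_adj]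
        exact Or.inr ⟨Finset.mem_coe.mpr (Finset.mem_image_of_mem _ (Finset.mem_univ u)), hu⟩
      refine ⟨(w.mapLe le_sup_left).concat hadj, ?_⟩
      rwa [SimpleGraph.Walk.metricLength_concat, SimpleGraph.Walk.metricLength_mapLe]
  refine ⟨H.edgeFinset, fun e he => H.not_isDiag_of_mem_edgeFinset he, ?_, fun v hv u => ?_⟩
  · have hsub : H.edgeFinset ⊆ G.edgeFinset ∪ star := by
      intro e he
      rw [SimpleGraph.mem_edgeFinset, SimpleGraph.edgeSet_sup, SimpleGraph.edgeSet_fromEdgeSet] at he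
      rw [Finset.mem_union, SimpleGraph.mem_edgeFinset]
      exact he.imp id fun h => h.1
    have h₁ : H.edgeFinset.card ≤ D * K.card + Fintype.card X :=
      (Finset.card_le_card hsub).trans <| (Finset.card_union_le _ _).trans <|
        add_le_add hcard Finset.card_image_le
    have h₂ : (H.edgeFinset.card : ℝ) ≤ ((D * K.card : ℕ) : ℝ) + Fintype.card X := by
      exact_mod_cast h₁
    linarith
  · obtain ⟨w, hw⟩ := hwalk v hv u
    refine ⟨w.length, fun i => w.getVert i, by simp, by simp, fun i => ?_, ?_⟩
    · rw [SimpleGraph.mem_edgeFinset]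
      exact w.adj_getVert_succ i.isLt
    · refine le_trans (le_of_eq ?_) hw
      rw [← SimpleGraph.Walk.sum_dist_getVert]
      simp
end

section
/- There exists a universal constant C > 0 such that for every finite subset X of a real inner product space with |X| = n, every set of terminals K ⊆ X with |K| = k ≥ 2, and every integer t ≥ 1, there exists a set E of unordered pairs of distinct points of X with |E| ≤ C·k^{1+1/t²} + n such that for every v ∈ K and u ∈ X there exists a finite sequence v = x₀, x₁, …, x_m = u with {x_i, x_{i+1}} ∈ E for every 0 ≤ i < m and Σ_{i=0}^{m−1} ‖x_i − x_{i+1}‖ ≤ C·t·‖v−u‖. -/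
section GaussianWeights

open MeasureTheory

/-- Finitely many measurable sets induce weights on the finite families of indices. -/
lemma exists_weights_of_sets {Ω ι : Type*} [MeasurableSpace Ω] [DecidableEq ι]
    (m : Measure Ω) (Q : Finset ι) (H : ι → Set Ω) (hm : ∀ x, MeasurableSet (H x))
    (hf : ∀ x, m (H x) ≠ ⊤) :
    ∃ μ : Finset ι → ℝ, (∀ S, 0 ≤ μ S) ∧ ∀ x ∈ Q, ∀ y ∈ Q,
      ∑ S ∈ Q.powerset with x ∈ S ∧ y ∈ S, μ S = m.real (H x ∩ H y) := by
  classical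
  let T : Ω → Finset ι := fun ω ↦ {z ∈ Q | ω ∈ H z}
  refine ⟨fun S ↦ m.real (T ⁻¹' {S}), fun S ↦ measureReal_nonneg, fun x hx y hy ↦ ?_⟩
  have hpre : T ⁻¹' ((Q.powerset.filter fun S ↦ x ∈ S ∧ y ∈ S : Finset (Finset ι)) :
      Set (Finset ι)) = H x ∩ H y := by
    ext ω
    simp [T, hx, hy, Finset.filter_subset]
  have hTm : ∀ S : Finset ι, MeasurableSet (T ⁻¹' {S}) := by
    intro S
    have : T ⁻¹' {S} = {ω | S ⊆ Q} ∩ ⋂ z ∈ Q, {ω | ω ∈ H z ↔ z ∈ S} := by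
      ext ω
      simp only [T, Set.mem_preimage, Set.mem_singleton_iff, Set.mem_inter_iff, Set.mem_ofPred_eq,
        Set.mem_iInter, Finset.ext_iff, Finset.mem_filter]
      constructor
      · intro h
        exact ⟨fun z hz ↦ ((h z).2 hz).1, fun z hz ↦ by simpa [hz] using h z⟩
      · rintro ⟨h1, h2⟩ z
        exact ⟨fun h ↦ (h2 z h.1).1 h.2, fun h ↦ ⟨h1 h, (h2 z (h1 h)).2 h⟩⟩
    rw [this]
    refine (MeasurableSet.const _).inter (Finset.measurableSet_biInter _ fun z _ ↦ ?_)
    by_cases hz : z ∈ S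
    · simpa [hz] using hm z
    · simp only [hz, iff_false]
      exact (hm z).compl
  rw [← hpre]
  refine sum_measureReal_preimage_singleton _ (fun S _ ↦ hTm S) fun S hS ↦ ?_
  refine ne_top_of_le_ne_top (hf x) (measure_mono fun ω hω ↦ ?_)
  have h1 : T ω = S := hω
  have h2 : x ∈ T ω := h1 ▸ (Finset.mem_filter.1 hS).2.1
  exact (Finset.mem_filter.1 h2).2

section Gaussian

variable {W : Type*} [NormedAddCommGroup W] [InnerProductSpace ℝ W] [FiniteDimensional ℝ W]
  [MeasurableSpace W] [BorelSpace W]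

lemma integrable_exp_neg_mul_sq_norm {b : ℝ} (hb : 0 < b) :
    Integrable fun v : W ↦ Real.exp (-b * ‖v‖ ^ 2) := by
  refine Integrable.of_integral_ne_zero ?_
  rw [GaussianFourier.integral_rexp_neg_mul_sq_norm hb]
  positivity

lemma min_ge_of_sq {p q l : ℝ} :
    2 * l * (p * q) - l ^ 2 * (p ^ 2 + q ^ 2) ≤ min (p ^ 2) (q ^ 2) := by
  rcases le_total (p ^ 2) (q ^ 2) with h | h
  · rw [min_eq_left h]
    nlinarith [sq_nonneg (p - l * q), sq_nonneg (l * p)]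
  · rw [min_eq_right h]
    nlinarith [sq_nonneg (q - l * p), sq_nonneg (l * q)]

/-- Hypographs of translated Gaussian densities: their overlaps decay like a Gaussian. -/
lemma exists_gaussian_sets {a : ℝ} (ha : 0 < a) :
    ∃ H : W → Set (W × ℝ), (∀ x, MeasurableSet (H x)) ∧ (∀ x, volume (H x) ≠ ⊤) ∧
      (∀ x, volume.real (H x) = 1) ∧ ∀ x y,
        Real.exp (-a * dist x y ^ 2) / 2 ≤ volume.real (H x ∩ H y) ∧
        volume.real (H x ∩ H y) ≤ Real.exp (-(a * dist x y ^ 2 / 2)) := by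
  have h2a : 0 < 2 * a := by positivity
  set Z : ℝ := ∫ v : W, Real.exp (-(2 * a) * ‖v‖ ^ 2) with hZdef
  have hZ : 0 < Z := by
    rw [hZdef, GaussianFourier.integral_rexp_neg_mul_sq_norm h2a]; positivity
  let h : W → W → ℝ := fun x ω ↦ Real.exp (-a * ‖ω - x‖ ^ 2) / √Z
  have hsq : ∀ x ω, h x ω ^ 2 = Real.exp (-(2 * a) * ‖ω - x‖ ^ 2) / Z := by
    intro x ω
    simp only [h, div_pow, Real.sq_sqrt hZ.le, ← Real.exp_nat_mul]
    congr 2; push_cast; ring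
  have hsqi : ∀ x, Integrable fun ω ↦ h x ω ^ 2 := by
    intro x
    simp only [hsq]
    exact ((integrable_exp_neg_mul_sq_norm h2a).comp_sub_right x).div_const Z
  have hsqI : ∀ x, ∫ ω, h x ω ^ 2 = 1 := by
    intro x
    simp only [hsq]
    rw [integral_div, integral_sub_right_eq_self (fun v : W ↦ Real.exp (-(2 * a) * ‖v‖ ^ 2)) x,
      ← hZdef, div_self hZ.ne']
  have hmul : ∀ x y ω, h x ω * h y ω =
      Real.exp (-(a * dist x y ^ 2 / 2)) * h (midpoint ℝ x y) ω ^ 2 := by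
    intro x y ω
    rw [hsq]
    simp only [h]
    rw [div_mul_div_comm, Real.mul_self_sqrt hZ.le, ← Real.exp_add, mul_div_assoc', ← Real.exp_add]
    congr 2
    have h1 : ω - midpoint ℝ x y = (1 / 2 : ℝ) • ((ω - x) + (ω - y)) := by
      rw [midpoint_eq_smul_add, invOf_eq_inv]
      module
    have h2 : dist x y = ‖(ω - x) - (ω - y)‖ := by
      rw [dist_comm, dist_eq_norm]; congr 1; abel
    rw [h1, h2, norm_smul, mul_pow]
    have := parallelogram_law_with_norm ℝ (ω - x) (ω - y)
    rw [Real.norm_of_nonneg (by norm_num)]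
    linear_combination (a / 2) * this
  have hmuli : ∀ x y, Integrable fun ω ↦ h x ω * h y ω := by
    intro x y
    simp only [hmul]
    exact (hsqi _).const_mul _
  have hmulI : ∀ x y, ∫ ω, h x ω * h y ω = Real.exp (-(a * dist x y ^ 2 / 2)) := by
    intro x y
    simp only [hmul]
    rw [integral_const_mul, hsqI, mul_one]
  have hmeas : ∀ x, Measurable fun ω ↦ h x ω ^ 2 := by
    intro x
    have : Continuous fun ω ↦ h x ω ^ 2 := by fun_prop
    exact this.measurable
  have hpos : ∀ x ω, 0 ≤ h x ω := fun x ω ↦ by positivity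
  have hreg : ∀ f : W → ℝ, Integrable f → (∀ ω, 0 ≤ f ω) →
      volume (regionBetween 0 f Set.univ) = ENNReal.ofReal (∫ ω, f ω) := by
    intro f hf hf0
    have := volume_regionBetween_eq_integral (μ := (volume : Measure W)) (f := 0) (g := f)
      (s := Set.univ) integrableOn_zero hf.integrableOn MeasurableSet.univ (fun ω _ ↦ hf0 ω)
    rw [Measure.volume_eq_prod]
    simpa only [Pi.sub_apply, Pi.zero_apply, sub_zero, Measure.restrict_univ] using this
  let H : W → Set (W × ℝ) := fun x ↦ regionBetween 0 (fun ω ↦ h x ω ^ 2) Set.univ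
  have hH : ∀ x, volume (H x) = 1 := by
    intro x
    simp only [H]
    rw [hreg _ (hsqi x) (fun ω ↦ sq_nonneg _), hsqI, ENNReal.ofReal_one]
  refine ⟨H, fun x ↦ measurableSet_regionBetween measurable_zero (hmeas x) MeasurableSet.univ,
    fun x ↦ by simp [hH x], fun x ↦ by simp [measureReal_def, hH x], fun x y ↦ ?_⟩
  have hmin : Integrable fun ω ↦ min (h x ω ^ 2) (h y ω ^ 2) := (hsqi x).inf (hsqi y)
  have hinter : H x ∩ H y = regionBetween 0 (fun ω ↦ min (h x ω ^ 2) (h y ω ^ 2)) Set.univ := by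
    ext ⟨ω, u⟩
    simp [H, regionBetween]
    tauto
  have hmin0 : ∀ ω, 0 ≤ min (h x ω ^ 2) (h y ω ^ 2) := fun ω ↦ le_min (sq_nonneg _) (sq_nonneg _)
  have hval : volume.real (H x ∩ H y) = ∫ ω, min (h x ω ^ 2) (h y ω ^ 2) := by
    rw [hinter, measureReal_def, hreg _ hmin hmin0, ENNReal.toReal_ofReal (integral_nonneg hmin0)]
  rw [hval]
  constructor
  · set A := Real.exp (-(a * dist x y ^ 2 / 2)) with hA
    have hAsq : Real.exp (-a * dist x y ^ 2) = A ^ 2 := by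
      rw [hA, ← Real.exp_nat_mul]; congr 1; push_cast; ring
    have hle := integral_mono (((hmuli x y).const_mul (2 * (A / 2))).sub
      (((hsqi x).add (hsqi y)).const_mul ((A / 2) ^ 2))) hmin
      (fun ω ↦ min_ge_of_sq (p := h x ω) (q := h y ω) (l := A / 2))
    have hI : ∫ ω, (2 * (A / 2) * (h x ω * h y ω) - (A / 2) ^ 2 * (h x ω ^ 2 + h y ω ^ 2)) =
        2 * (A / 2) * A - (A / 2) ^ 2 * (1 + 1) := by
      have hadd : Integrable fun ω ↦ h x ω ^ 2 + h y ω ^ 2 := (hsqi x).add (hsqi y)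
      rw [integral_sub ((hmuli x y).const_mul _) (hadd.const_mul _), integral_const_mul,
        integral_const_mul, integral_add (hsqi x) (hsqi y), hsqI, hsqI, hmulI]
    have hle' : 2 * (A / 2) * A - (A / 2) ^ 2 * (1 + 1) ≤
        ∫ ω, min (h x ω ^ 2) (h y ω ^ 2) := hI ▸ hle
    rw [hAsq]
    linarith
  · rw [← hmulI x y]
    refine integral_mono hmin (hmuli x y) fun ω ↦ ?_
    rcases le_total (h x ω) (h y ω) with hxy | hxy
    · exact (min_le_left _ _).trans (by rw [sq]; exact mul_le_mul_of_nonneg_left hxy (hpos x ω))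
    · exact (min_le_right _ _).trans (by rw [sq]; exact mul_le_mul_of_nonneg_right hxy (hpos y ω))

end Gaussian

/-- Weights on the subsets of a finite Euclidean point set with Gaussian overlap. -/
lemma exists_gaussian_weights {V : Type*} [NormedAddCommGroup V] [InnerProductSpace ℝ V]
    [DecidableEq V] (Q : Finset V) {a : ℝ} (ha : 0 < a) :
    ∃ μ : Finset V → ℝ, (∀ S, 0 ≤ μ S) ∧ (∀ x ∈ Q, ∑ S ∈ Q.powerset with x ∈ S, μ S = 1) ∧
      ∀ x ∈ Q, ∀ y ∈ Q,
        Real.exp (-a * dist x y ^ 2) / 2 ≤ ∑ S ∈ Q.powerset with x ∈ S ∧ y ∈ S, μ S ∧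
        ∑ S ∈ Q.powerset with x ∈ S ∧ y ∈ S, μ S ≤ Real.exp (-(a * dist x y ^ 2 / 2)) := by
  classical
  let W := Submodule.span ℝ (Q : Set V)
  let _ : MeasurableSpace W := borel W
  have : BorelSpace W := ⟨rfl⟩
  have : FiniteDimensional ℝ W := FiniteDimensional.span_finset ℝ Q
  obtain ⟨H, hm, hf, h1, hov⟩ := exists_gaussian_sets (W := W) ha
  let c : V → W := fun x ↦ if h : x ∈ W then ⟨x, h⟩ else 0
  have hc : ∀ x ∈ Q, ((c x : W) : V) = x := by
    intro x hx
    have : x ∈ W := Submodule.subset_span hx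
    simp [c, this]
  obtain ⟨μ, h0, hμ⟩ := exists_weights_of_sets volume Q (fun x ↦ H (c x)) (fun x ↦ hm _)
    (fun x ↦ hf _)
  refine ⟨μ, h0, fun x hx ↦ ?_, fun x hx y hy ↦ ?_⟩
  · simpa [h1] using hμ x hx x hx
  · have hd : dist (c x) (c y) = dist x y := by rw [Subtype.dist_eq, hc x hx, hc y hy]
    rw [hμ x hx y hy, ← hd]
    exact hov _ _

end GaussianWeights

/-- `ShortPath E a b ℓ`: some path with edges in `E` joins `a` to `b` and has length at most `ℓ`. -/
inductive ShortPath {α : Type*} [PseudoMetricSpace α] (E : Finset (Sym2 α)) : α → α → ℝ → Prop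
  | refl (a : α) {ℓ : ℝ} (h : 0 ≤ ℓ) : ShortPath E a a ℓ
  | cons {a b c : α} {ℓ ℓ' : ℝ} (h : s(a, b) ∈ E) (hp : ShortPath E b c ℓ)
      (hl : dist a b + ℓ ≤ ℓ') : ShortPath E a c ℓ'

namespace ShortPath

variable {α : Type*} [PseudoMetricSpace α] {E E' : Finset (Sym2 α)} {a b c : α} {ℓ ℓ' : ℝ}

lemma mono (h : ShortPath E a b ℓ) (hE : E ⊆ E') (hl : ℓ ≤ ℓ') : ShortPath E' a b ℓ' := by
  induction h generalizing ℓ' with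
  | refl a h => exact refl a (h.trans hl)
  | cons h _ hl' ih => exact cons (hE h) (ih le_rfl) (hl'.trans hl)

lemma trans (h : ShortPath E a b ℓ) (h' : ShortPath E b c ℓ') : ShortPath E a c (ℓ + ℓ') := by
  induction h with
  | refl a h => exact h'.mono subset_rfl (by linarith)
  | cons h _ hl ih => exact cons h (ih h') (by linarith)

lemma of_mem (h : s(a, b) ∈ E) (hl : dist a b ≤ ℓ) : ShortPath E a b ℓ :=
  cons h (refl b le_rfl) (by simpa using hl)

lemma symm (h : ShortPath E a b ℓ) : ShortPath E b a ℓ := by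
  induction h with
  | refl a h => exact refl a h
  | @cons a b c ℓ ℓ' h _ hl ih =>
    refine (ih.trans (of_mem (b := a) (by rwa [Sym2.eq_swap]) le_rfl)).mono subset_rfl ?_
    rw [dist_comm]; linarith

lemma exists_fin (h : ShortPath E a b ℓ) :
    ∃ (m : ℕ) (x : Fin (m + 1) → α), x 0 = a ∧ x (Fin.last m) = b ∧
      (∀ i : Fin m, s(x i.castSucc, x i.succ) ∈ E) ∧
      ∑ i : Fin m, dist (x i.castSucc) (x i.succ) ≤ ℓ := by
  induction h with
  | refl a h => exact ⟨0, fun _ ↦ a, rfl, rfl, fun i ↦ i.elim0, by simpa using h⟩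
  | @cons a b c ℓ ℓ' h _ hl ih =>
    obtain ⟨m, x, h0, hm, hE, hs⟩ := ih
    refine ⟨m + 1, Fin.cons a x, rfl, ?_, ?_, ?_⟩
    · rw [← Fin.succ_last, Fin.cons_succ, hm]
    · intro i
      refine Fin.cases ?_ (fun j ↦ ?_) i
      · simpa [h0] using h
      · simpa [← Fin.succ_castSucc] using hE j
    · rw [Fin.sum_univ_succ]
      simp only [Fin.castSucc_zero, Fin.cons_zero, Fin.cons_succ, ← Fin.succ_castSucc, h0]
      linarith

end ShortPath

/-- Conditioning the Gaussian weights on having bounded diameter. -/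
lemma exists_bounded_weights {V : Type*} [NormedAddCommGroup V] [InnerProductSpace ℝ V]
    [DecidableEq V] (Q : Finset V) {a D : ℝ} (ha : 0 < a) (hD : 0 ≤ D) :
    ∃ μ : Finset V → ℝ, (∀ S, 0 ≤ μ S) ∧
      (∀ S, μ S ≠ 0 → ∀ x ∈ S, ∀ y ∈ S, dist x y ≤ 2 * D) ∧
      (∀ x ∈ Q, ∑ S ∈ Q.powerset with x ∈ S, μ S ≤ 1) ∧
      ∀ x ∈ Q, ∀ y ∈ Q, Real.exp (-a * dist x y ^ 2) / 2 - Q.card * Real.exp (-(a * D ^ 2 / 2)) ≤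
        ∑ S ∈ Q.powerset with x ∈ S ∧ y ∈ S, μ S := by
  classical
  obtain ⟨μ, h0, h1, hov⟩ := exists_gaussian_weights Q ha
  refine ⟨fun S ↦ if ∀ x ∈ S, ∀ y ∈ S, dist x y ≤ 2 * D then μ S else 0, fun S ↦ ?_,
    fun S hS ↦ ?_, fun x hx ↦ ?_, fun x hx y hy ↦ ?_⟩
  · dsimp only
    split_ifs
    exacts [h0 S, le_rfl]
  · dsimp only at hS
    split_ifs at hS with h
    exacts [h, absurd rfl hS]
  · rw [← h1 x hx]
    refine Finset.sum_le_sum fun S _ ↦ ?_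
    split_ifs
    exacts [le_rfl, h0 S]
  · have hpt : ∀ S ∈ Q.powerset.filter (fun S ↦ x ∈ S ∧ y ∈ S),
        μ S - (if ∀ x ∈ S, ∀ y ∈ S, dist x y ≤ 2 * D then μ S else 0) ≤
          ∑ z ∈ Q with D < dist x z, if x ∈ S ∧ z ∈ S then μ S else 0 := by
      intro S hS
      rw [Finset.mem_filter, Finset.mem_powerset] at hS
      have hnn : ∀ z ∈ Q.filter (fun z ↦ D < dist x z),
          0 ≤ if x ∈ S ∧ z ∈ S then μ S else 0 := by
        intro z _
        split_ifs
        exacts [h0 S, le_rfl]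
      by_cases hb : ∀ x ∈ S, ∀ y ∈ S, dist x y ≤ 2 * D
      · rw [if_pos hb, sub_self]
        exact Finset.sum_nonneg hnn
      · have : ∃ z ∈ S, D < dist x z := by
          by_contra! hcon
          refine hb fun u hu v hv ↦ (dist_triangle_left u v x).trans ?_
          linarith [hcon u hu, hcon v hv]
        obtain ⟨z, hz, hzD⟩ := this
        have := Finset.single_le_sum hnn (Finset.mem_filter.2 ⟨hS.1 hz, hzD⟩)
        rw [if_pos ⟨hS.2.1, hz⟩] at this
        rw [if_neg hb, sub_zero]
        exact this
    have hsum := Finset.sum_le_sum hpt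
    have hswap : ∑ S ∈ Q.powerset with x ∈ S ∧ y ∈ S,
        (∑ z ∈ Q with D < dist x z, if x ∈ S ∧ z ∈ S then μ S else 0) ≤
          Q.card * Real.exp (-(a * D ^ 2 / 2)) := by
      rw [Finset.sum_comm]
      calc _ ≤ ∑ z ∈ Q with D < dist x z, Real.exp (-(a * D ^ 2 / 2)) := by
            refine Finset.sum_le_sum fun z hz ↦ ?_
            rw [Finset.mem_filter] at hz
            calc _ ≤ ∑ S ∈ Q.powerset, if x ∈ S ∧ z ∈ S then μ S else 0 := by
                  refine Finset.sum_le_sum_of_subset_of_nonneg (Finset.filter_subset _ _) ?_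
                  intro S _ _
                  split_ifs
                  exacts [h0 S, le_rfl]
              _ ≤ Real.exp (-(a * dist x z ^ 2 / 2)) := by
                  rw [← Finset.sum_filter]
                  exact (hov x hx z hz.1).2
              _ ≤ _ := by gcongr; exact hz.2.le
        _ ≤ _ := by
            rw [Finset.sum_const, nsmul_eq_mul]
            gcongr
            exact Finset.filter_subset _ _
    rw [Finset.sum_sub_distrib] at hsum
    linarith [(hov x hx y hy).1]

/-- One greedy step: some set covers many pairs relative to its size. -/
lemma exists_efficient_set {α : Type*} [DecidableEq α] (Q : Finset α) (μ : Finset α → ℝ)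
    (h0 : ∀ S, 0 ≤ μ S) (h1 : ∀ x ∈ Q, ∑ S ∈ Q.powerset with x ∈ S, μ S ≤ 1) {p : ℝ} (hp : 0 < p)
    (U : Finset (α × α)) (hne : U.Nonempty)
    (hU : ∀ u ∈ U, p ≤ ∑ S ∈ Q.powerset with u.1 ∈ S ∧ u.2 ∈ S, μ S) :
    ∃ S ∈ Q.powerset, μ S ≠ 0 ∧ (U.filter fun u ↦ u.1 ∈ S ∧ u.2 ∈ S).Nonempty ∧
      p * U.card * S.card ≤ Q.card * (U.filter fun u ↦ u.1 ∈ S ∧ u.2 ∈ S).card := by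
  by_contra! hcon
  set cov : Finset α → Finset (α × α) := fun S ↦ U.filter fun u ↦ u.1 ∈ S ∧ u.2 ∈ S with hcov
  have hlt : ∀ S ∈ Q.powerset, μ S ≠ 0 → (cov S).Nonempty →
      μ S * (Q.card * (cov S).card) < μ S * (p * U.card * S.card) := fun S hS hμ hc ↦
    mul_lt_mul_of_pos_left (hcon S hS hμ hc) ((h0 S).lt_of_ne' hμ)
  have hle : ∀ S ∈ Q.powerset,
      μ S * (Q.card * (cov S).card) ≤ μ S * (p * U.card * S.card) := by
    intro S hS
    by_cases hμ : μ S = 0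
    · simp [hμ]
    by_cases hc : (cov S).Nonempty
    · exact (hlt S hS hμ hc).le
    · rw [Finset.not_nonempty_iff_eq_empty.1 hc]
      have := h0 S
      simp only [Finset.card_empty, Nat.cast_zero, mul_zero]
      positivity
  obtain ⟨u, hu⟩ := hne
  obtain ⟨S₀, hS₀, hμ₀⟩ := Finset.exists_ne_zero_of_sum_ne_zero (hp.trans_le (hU u hu)).ne'
  rw [Finset.mem_filter] at hS₀
  have hstrict := Finset.sum_lt_sum hle ⟨S₀, hS₀.1, hlt S₀ hS₀.1 hμ₀
    ⟨u, Finset.mem_filter.2 ⟨hu, hS₀.2⟩⟩⟩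
  have hL : (Q.card : ℝ) * (p * U.card) ≤
      ∑ S ∈ Q.powerset, μ S * (Q.card * (cov S).card) := by
    have : ∑ S ∈ Q.powerset, μ S * (Q.card * (cov S).card) =
        Q.card * ∑ u ∈ U, ∑ S ∈ Q.powerset with u.1 ∈ S ∧ u.2 ∈ S, μ S := by
      simp only [Finset.sum_filter]
      rw [Finset.sum_comm, Finset.mul_sum]
      refine Finset.sum_congr rfl fun S _ ↦ ?_
      rw [← Finset.sum_filter, Finset.sum_const, nsmul_eq_mul]
      ring
    rw [this]
    gcongr
    calc p * U.card = ∑ u ∈ U, p := by simp [mul_comm]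
      _ ≤ _ := Finset.sum_le_sum hU
  have hR : ∑ S ∈ Q.powerset, μ S * (p * U.card * S.card) ≤ p * U.card * Q.card := by
    have : ∑ S ∈ Q.powerset, μ S * (p * U.card * S.card) =
        p * U.card * ∑ x ∈ Q, ∑ S ∈ Q.powerset with x ∈ S, μ S := by
      simp only [Finset.sum_filter]
      rw [Finset.sum_comm, Finset.mul_sum]
      refine Finset.sum_congr rfl fun S hS ↦ ?_
      rw [← Finset.sum_filter, Finset.sum_const, nsmul_eq_mul,
        Finset.filter_mem_eq_inter, Finset.inter_eq_right.2 (Finset.mem_powerset.1 hS)]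
      ring
    rw [this]
    gcongr
    calc _ ≤ ∑ x ∈ Q, (1 : ℝ) := Finset.sum_le_sum h1
      _ = Q.card := by simp
  linarith

/-- Greedy covering of pairs by sets, with a logarithmic loss in the average degree. -/
lemma exists_cover {α : Type*} [DecidableEq α] (Q : Finset α) (μ : Finset α → ℝ)
    (h0 : ∀ S, 0 ≤ μ S) (h1 : ∀ x ∈ Q, ∑ S ∈ Q.powerset with x ∈ S, μ S ≤ 1) {p : ℝ} (hp : 0 < p)
    (U : Finset (α × α)) (hU : ∀ u ∈ U, p ≤ ∑ S ∈ Q.powerset with u.1 ∈ S ∧ u.2 ∈ S, μ S)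
    {M : ℝ} (hM : 1 ≤ M) (hUM : U.card ≤ Q.card * M) :
    ∃ F ⊆ Q.powerset, (∀ S ∈ F, μ S ≠ 0) ∧
      ((∑ S ∈ F, S.card : ℕ) : ℝ) + (U.filter fun u ↦ ∀ S ∈ F, ¬ (u.1 ∈ S ∧ u.2 ∈ S)).card ≤
        Q.card * (1 + (1 + Real.log M) / p) := by
  induction U using Finset.strongInduction generalizing M with
  | H U ih =>
  have hlog : 0 ≤ Real.log M := Real.log_nonneg hM
  by_cases hsmall : (U.card : ℝ) ≤ Q.card
  · refine ⟨∅, by simp, by simp, ?_⟩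
    simp only [Finset.sum_empty, Nat.cast_zero, zero_add, Finset.notMem_empty, false_imp_iff,
      implies_true, Finset.filter_true]
    refine hsmall.trans (le_mul_of_one_le_right (by positivity) ?_)
    have : 0 ≤ (1 + Real.log M) / p := by positivity
    linarith
  push Not at hsmall
  have hUpos : (0 : ℝ) < U.card := lt_of_le_of_lt (by positivity) hsmall
  have hne : U.Nonempty := Finset.card_pos.1 (by exact_mod_cast hUpos)
  have hQpos : (0 : ℝ) < Q.card := by
    by_contra! h
    have : (Q.card : ℝ) * M ≤ 0 := mul_nonpos_of_nonpos_of_nonneg h (by linarith)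
    linarith
  obtain ⟨S, hSQ, hμS, hcne, hS⟩ := exists_efficient_set Q μ h0 h1 hp U hne hU
  set c := U.filter fun u ↦ u.1 ∈ S ∧ u.2 ∈ S with hc
  have hcU : c ⊆ U := Finset.filter_subset _ _
  have hcpos : (0 : ℝ) < c.card := by exact_mod_cast hcne.card_pos
  have hcard : ((U \ c).card : ℝ) = U.card - c.card := by
    rw [Finset.card_sdiff_of_subset hcU, Nat.cast_sub (Finset.card_le_card hcU)]
  have hScard : (S.card : ℝ) ≤ Q.card * (c.card / U.card / p) := by
    rw [div_div, mul_div_assoc', le_div_iff₀ (by positivity)]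
    linarith
  have hunc : ∀ F : Finset (Finset α), (U.filter fun u ↦ ∀ T ∈ insert S F,
      ¬ (u.1 ∈ T ∧ u.2 ∈ T)) = (U \ c).filter fun u ↦ ∀ T ∈ F, ¬ (u.1 ∈ T ∧ u.2 ∈ T) := by
    intro F
    ext u
    simp only [hc, Finset.mem_filter, Finset.mem_sdiff, Finset.forall_mem_insert]
    tauto
  have hins : ∀ F : Finset (Finset α), ((∑ T ∈ insert S F, T.card : ℕ) : ℝ) ≤
      S.card + ((∑ T ∈ F, T.card : ℕ) : ℝ) := by
    intro F
    by_cases hSF : S ∈ F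
    · rw [Finset.insert_eq_of_mem hSF]; linarith [(Nat.cast_nonneg S.card : (0 : ℝ) ≤ _)]
    · rw [Finset.sum_insert hSF]; push_cast; exact le_rfl
  by_cases hsmall' : ((U \ c).card : ℝ) ≤ Q.card
  · refine ⟨insert S ∅, by simpa using hSQ, by simpa using hμS, ?_⟩
    rw [hunc]
    have h3 := hins ∅
    simp only [Finset.sum_empty, Nat.cast_zero, add_zero, Finset.notMem_empty, false_imp_iff,
      implies_true, Finset.filter_true] at h3 ⊢
    have h4 : (c.card : ℝ) / U.card / p ≤ (1 + Real.log M) / p := by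
      gcongr
      rw [div_le_iff₀ hUpos]
      have : (c.card : ℝ) ≤ U.card := by exact_mod_cast Finset.card_le_card hcU
      nlinarith
    nlinarith
  · push Not at hsmall'
    have hU'pos : (0 : ℝ) < (U \ c).card := hQpos.trans hsmall'
    obtain ⟨F, hF, hFμ, hFc⟩ := ih (U \ c)
      (Finset.ssubset_iff_subset_ne.2 ⟨Finset.sdiff_subset, fun h ↦ by
        rw [h] at hcard; linarith⟩)
      (fun u hu ↦ hU u (Finset.mem_sdiff.1 hu).1)
      (M := (U \ c).card / Q.card) (by rw [le_div_iff₀ hQpos]; linarith)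
      (by rw [mul_div_cancel₀ _ hQpos.ne'])
    refine ⟨insert S F, Finset.insert_subset hSQ hF, Finset.forall_mem_insert _ _ _ |>.2
      ⟨hμS, hFμ⟩, ?_⟩
    rw [hunc]
    have h3 := hins F
    have h4 : (c.card : ℝ) / U.card + Real.log ((U \ c).card / Q.card) ≤ Real.log M := by
      have h5 := Real.one_sub_inv_le_log_of_pos (x := U.card / (U \ c).card) (by positivity)
      have h6 : Real.log (U.card / Q.card) ≤ Real.log M :=
        Real.log_le_log (by positivity) (by rw [div_le_iff₀ hQpos]; linarith)
      rw [Real.log_div hUpos.ne' hU'pos.ne', inv_div] at h5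
      rw [Real.log_div hUpos.ne' hQpos.ne'] at h6
      rw [Real.log_div hU'pos.ne' hQpos.ne']
      have h7 : (c.card : ℝ) / U.card = 1 - (U \ c).card / U.card := by
        rw [hcard]; field_simp; ring
      linarith
    have h8 : (c.card : ℝ) / U.card / p + (1 + Real.log ((U \ c).card / Q.card)) / p ≤
        (1 + Real.log M) / p := by
      rw [← add_div]
      exact div_le_div_of_nonneg_right (by linarith) hp.le
    nlinarith

/-- A star on a set of small diameter. -/
lemma exists_star {α : Type*} [PseudoMetricSpace α] [DecidableEq α] (S : Finset α) {r : ℝ}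
    (hS : ∀ x ∈ S, ∀ y ∈ S, dist x y ≤ r) :
    ∃ T : Finset (Sym2 α), (∀ e ∈ T, ¬ e.IsDiag ∧ ∀ v ∈ e, v ∈ S) ∧ T.card ≤ S.card ∧
      ∀ x ∈ S, ∀ y ∈ S, ShortPath T x y (2 * r) := by
  rcases S.eq_empty_or_nonempty with rfl | ⟨c, hc⟩
  · exact ⟨∅, by simp⟩
  have hr : 0 ≤ r := dist_nonneg.trans (hS c hc c hc)
  refine ⟨(S.erase c).image fun x ↦ s(x, c), ?_, Finset.card_image_le.trans
    (Finset.card_le_card (Finset.erase_subset _ _)), ?_⟩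
  · intro e he
    obtain ⟨x, hx, rfl⟩ := Finset.mem_image.1 he
    rw [Finset.mem_erase] at hx
    simp [hx, hc]
  · have key : ∀ x ∈ S, ShortPath ((S.erase c).image fun x ↦ s(x, c)) x c r := by
      intro x hx
      by_cases hxc : x = c
      · rw [hxc]; exact .refl c hr
      · exact .of_mem (Finset.mem_image_of_mem _ (Finset.mem_erase.2 ⟨hxc, hx⟩)) (hS x hx c hc)
    intro x hx y hy
    rw [two_mul]
    exact (key x hx).trans (key y hy).symm

/-- Edges realising all the pairs in `U` by short paths. -/
lemma exists_layer_edges {V : Type*} [NormedAddCommGroup V] [InnerProductSpace ℝ V]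
    [DecidableEq V] (Q : Finset V) (U : Finset (V × V)) {a D h M : ℝ} (ha : 0 < a) (hD : 0 ≤ D)
    (hhD : h ≤ 4 * D) (hM : 1 ≤ M)
    (hU : ∀ u ∈ U, u.1 ∈ Q ∧ u.2 ∈ Q ∧ dist u.1 u.2 ≤ h) (hUM : U.card ≤ Q.card * M)
    (hfar : Q.card * Real.exp (-(a * D ^ 2 / 2)) ≤ Real.exp (-(a * h ^ 2)) / 4) :
    ∃ E : Finset (Sym2 V), (∀ e ∈ E, ¬ e.IsDiag ∧ ∀ v ∈ e, v ∈ Q) ∧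
      (E.card : ℝ) ≤ Q.card * (1 + 4 * (1 + Real.log M) * Real.exp (a * h ^ 2)) ∧
      ∀ u ∈ U, ShortPath E u.1 u.2 (4 * D) := by
  obtain ⟨μ, h0, hdiam, h1, hov⟩ := exists_bounded_weights Q ha hD
  obtain ⟨F, hFQ, hFμ, hF⟩ := exists_cover Q μ h0 h1 (p := Real.exp (-(a * h ^ 2)) / 4)
    (by positivity) U (fun u hu ↦ by
      obtain ⟨hu1, hu2, hu3⟩ := hU u hu
      have h5 : Real.exp (-(a * h ^ 2)) ≤ Real.exp (-a * dist u.1 u.2 ^ 2) := by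
        rw [neg_mul]; gcongr
      linarith [hov u.1 hu1 u.2 hu2]) hM hUM
  have hstar : ∀ S : Finset V, ∃ T : Finset (Sym2 V), S ∈ F →
      (∀ e ∈ T, ¬ e.IsDiag ∧ ∀ v ∈ e, v ∈ S) ∧ T.card ≤ S.card ∧
      ∀ x ∈ S, ∀ y ∈ S, ShortPath T x y (2 * (2 * D)) := by
    intro S
    by_cases hS : S ∈ F
    · obtain ⟨T, hT⟩ := exists_star S (hdiam S (hFμ S hS))
      exact ⟨T, fun _ ↦ hT⟩
    · exact ⟨∅, fun h ↦ absurd h hS⟩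
  choose T hT using hstar
  set R := U.filter fun u ↦ ∀ S ∈ F, ¬ (u.1 ∈ S ∧ u.2 ∈ S)
  refine ⟨F.biUnion T ∪ (R.filter fun u ↦ u.1 ≠ u.2).image fun u ↦ s(u.1, u.2), ?_, ?_, ?_⟩
  · intro e he
    rcases Finset.mem_union.1 he with he | he
    · obtain ⟨S, hS, heS⟩ := Finset.mem_biUnion.1 he
      exact ⟨((hT S hS).1 e heS).1, fun v hv ↦
        Finset.mem_powerset.1 (hFQ hS) (((hT S hS).1 e heS).2 v hv)⟩
    · obtain ⟨u, hu, rfl⟩ := Finset.mem_image.1 he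
      rw [Finset.mem_filter] at hu
      obtain ⟨hu1, hu2, -⟩ := hU u (Finset.mem_filter.1 hu.1).1
      simp [hu.2, hu1, hu2]
  · have hcard : (F.biUnion T ∪ (R.filter fun u ↦ u.1 ≠ u.2).image fun u ↦ s(u.1, u.2)).card ≤
        ∑ S ∈ F, S.card + R.card :=
      (Finset.card_union_le _ _).trans (add_le_add
        (Finset.card_biUnion_le.trans (Finset.sum_le_sum fun S hS ↦ (hT S hS).2.1))
        (Finset.card_image_le.trans (Finset.card_le_card (Finset.filter_subset _ _))))
    have hcard' : ((F.biUnion T ∪ (R.filter fun u ↦ u.1 ≠ u.2).image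
        fun u ↦ s(u.1, u.2)).card : ℝ) ≤ ((∑ S ∈ F, S.card : ℕ) : ℝ) + R.card := by
      exact_mod_cast hcard
    refine hcard'.trans (hF.trans_eq ?_)
    rw [Real.exp_neg]
    field_simp
  · intro u hu
    by_cases hR : u ∈ R
    · by_cases huu : u.1 = u.2
      · rw [huu]; exact .refl _ (by positivity)
      · exact .of_mem (Finset.mem_union_right _ (Finset.mem_image_of_mem _
          (Finset.mem_filter.2 ⟨hR, huu⟩))) ((hU u hu).2.2.trans hhD)
    · have : ∃ S ∈ F, u.1 ∈ S ∧ u.2 ∈ S := by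
        by_contra! hcon
        exact hR (Finset.mem_filter.2 ⟨hu, fun S hS h ↦ hcon S hS h.1 h.2⟩)
      obtain ⟨S, hS, hu1, hu2⟩ := this
      refine ((hT S hS).2.2 _ hu1 _ hu2).mono ?_ (by linarith)
      exact (Finset.subset_biUnion_of_mem T hS).trans Finset.subset_union_left

/-- A maximal `ρ`-separated subset. -/
lemma exists_separated_net {α : Type*} [PseudoMetricSpace α] [DecidableEq α] (S : Finset α)
    {ρ : ℝ} (hρ : 0 ≤ ρ) :
    ∃ T ⊆ S, (∀ x ∈ T, ∀ y ∈ T, x ≠ y → ρ < dist x y) ∧ ∀ x ∈ S, ∃ y ∈ T, dist x y ≤ ρ := by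
  induction S using Finset.induction_on with
  | empty => exact ⟨∅, by simp⟩
  | insert a S _ ih =>
    obtain ⟨T, hTS, hsep, hcov⟩ := ih
    by_cases h : ∃ y ∈ T, dist a y ≤ ρ
    · exact ⟨T, hTS.trans (Finset.subset_insert _ _), hsep,
        Finset.forall_mem_insert _ _ _ |>.2 ⟨h, hcov⟩⟩
    · push Not at h
      refine ⟨insert a T, Finset.insert_subset_insert _ hTS, ?_, ?_⟩
      · intro x hx y hy hxy
        rcases Finset.mem_insert.1 hx with rfl | hx' <;> rcases Finset.mem_insert.1 hy with rfl | hy'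
        · exact absurd rfl hxy
        · exact h y hy'
        · rw [dist_comm]; exact h x hx'
        · exact hsep x hx' y hy' hxy
      · refine Finset.forall_mem_insert _ _ _ |>.2
          ⟨⟨a, Finset.mem_insert_self _ _, by simpa using hρ⟩, fun x hx ↦ ?_⟩
        obtain ⟨y, hy, hxy⟩ := hcov x hx
        exact ⟨y, Finset.mem_insert_of_mem hy, hxy⟩

/-- Disjoint balls with many points contain many points outside a separated set. -/
lemma card_mul_le_of_dense_balls {α : Type*} [MetricSpace α] [DecidableEq α]
    {P Q N : Finset α} {s M : ℝ} (hM : 2 ≤ M) (hNP : N ⊆ P)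
    (hN : ∀ x ∈ N, ∀ y ∈ N, x ≠ y → 2 * s < dist x y)
    (hQ : ∀ x ∈ Q, ∀ y ∈ Q, x ≠ y → 2 * s < dist x y)
    (hdense : ∀ q ∈ Q, M ≤ (P.filter fun x ↦ dist q x ≤ s).card) :
    Q.card * M ≤ 2 * (P.card - N.card) := by
  set B : α → Finset α := fun q ↦ P.filter fun x ↦ dist q x ≤ s with hB
  have hclose : ∀ q x y : α, dist q x ≤ s → dist q y ≤ s → dist x y ≤ 2 * s := fun q x y hx hy ↦
    (dist_triangle_left x y q).trans (by linarith)
  have hdisj : (Q : Set α).PairwiseDisjoint fun q ↦ B q \ N := by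
    intro q hq q' hq' hqq
    refine Finset.disjoint_left.2 fun x hx hx' ↦ (hQ q hq q' hq' hqq).not_ge ?_
    simp only [hB, Finset.mem_sdiff, Finset.mem_filter] at hx hx'
    exact hclose x q q' (by rw [dist_comm]; exact hx.1.2) (by rw [dist_comm]; exact hx'.1.2)
  have hsub : (Q.biUnion fun q ↦ B q \ N) ⊆ P \ N := Finset.biUnion_subset.2 fun q _ ↦
    Finset.sdiff_subset_sdiff (Finset.filter_subset _ _) subset_rfl
  have hcard := Finset.card_le_card hsub
  rw [Finset.card_biUnion hdisj] at hcard
  have hcard' : ∑ q ∈ Q, ((B q \ N).card : ℝ) ≤ P.card - N.card := by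
    rw [← Nat.cast_sub (Finset.card_le_card hNP), ← Finset.card_sdiff_of_subset hNP]
    exact_mod_cast hcard
  have hlow : ∀ q ∈ Q, M / 2 ≤ ((B q \ N).card : ℝ) := by
    intro q hq
    have h1 : (B q ∩ N).card ≤ 1 := by
      refine Finset.card_le_one.2 fun x hx y hy ↦ ?_
      simp only [hB, Finset.mem_inter, Finset.mem_filter] at hx hy
      by_contra hxy
      exact (hN x hx.2 y hy.2 hxy).not_ge (hclose q x y hx.1.2 hy.1.2)
    have h2 : ((B q \ N).card : ℝ) + (B q ∩ N).card = (B q).card := by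
      exact_mod_cast Finset.card_sdiff_add_card_inter _ _
    have h3 : ((B q ∩ N).card : ℝ) ≤ 1 := by exact_mod_cast h1
    linarith [hdense q hq]
  have := Finset.sum_le_sum hlow
  rw [Finset.sum_const, nsmul_eq_mul] at this
  linarith

/-- Points with a near neighbour are few compared with the complement of a separated set. -/
lemma card_le_of_near_neighbour {α : Type*} [MetricSpace α] [DecidableEq α]
    {P Q N : Finset α} {s : ℝ} (hs : 0 ≤ s) (hNP : N ⊆ P) (hQP : Q ⊆ P)
    (hN : ∀ x ∈ N, ∀ y ∈ N, x ≠ y → 2 * s < dist x y)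
    (hQ : ∀ x ∈ Q, ∃ y ∈ P, y ≠ x ∧ dist x y ≤ s) :
    (Q.card : ℝ) ≤ 2 * (P.card - N.card) := by
  have hQ' : ∀ x, ∃ y, x ∈ Q → y ∈ P ∧ y ≠ x ∧ dist x y ≤ s := by
    intro x
    by_cases hx : x ∈ Q
    · obtain ⟨y, hy⟩ := hQ x hx
      exact ⟨y, fun _ ↦ hy⟩
    · exact ⟨x, fun h ↦ absurd h hx⟩
  choose f hf using hQ'
  have h1 : (Q ∩ N).card ≤ (P \ N).card := by
    refine Finset.card_le_card_of_injOn f ?_ ?_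
    · intro x hx
      have hx' := Finset.mem_inter.1 hx
      obtain ⟨hyP, hne, hd⟩ := hf x hx'.1
      refine Finset.mem_coe.2 (Finset.mem_sdiff.2 ⟨hyP, fun hyN ↦ ?_⟩)
      linarith [hN x hx'.2 _ hyN hne.symm]
    · intro x hx y hy hxy
      have hx' := Finset.mem_inter.1 hx
      have hy' := Finset.mem_inter.1 hy
      by_contra hne
      have h2 := hN x hx'.2 y hy'.2 hne
      have h3 := (hf x hx'.1).2.2
      have h4 := (hf y hy'.1).2.2
      rw [hxy] at h3
      linarith [dist_triangle_right x y (f y)]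
  have h2 : (Q \ N).card ≤ (P \ N).card :=
    Finset.card_le_card (Finset.sdiff_subset_sdiff hQP subset_rfl)
  have h3 : (Q \ N).card + (Q ∩ N).card = Q.card := Finset.card_sdiff_add_card_inter _ _
  rw [← Nat.cast_sub (Finset.card_le_card hNP), ← Finset.card_sdiff_of_subset hNP]
  exact_mod_cast (by omega : Q.card ≤ 2 * (P \ N).card)

/-- A hierarchy of separated sets of centres of dense balls. -/
lemma exists_hierarchy {α : Type*} [MetricSpace α] [DecidableEq α] (P : Finset α)
    (s M : ℕ → ℝ) (hs : ∀ j, 0 ≤ s j) (hM0 : M 0 = 1) (hM : ∀ j, 2 ≤ M (j + 1)) :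
    ∃ Q : ℕ → Finset α, (∀ j, Q j ⊆ P) ∧
      (∀ x ∈ P, ∀ y ∈ P, x ≠ y → dist x y ≤ s 0 → x ∈ Q 0) ∧
      (∀ j, ∀ q ∈ P, (∀ z ∈ Q (j + 1), 2 * s (j + 1) < dist q z) →
        ((P.filter fun x ↦ dist q x ≤ s (j + 1)).card : ℝ) ≤ M (j + 1)) ∧
      (∀ j, (P.card : ℝ) < M (j + 1) → Q (j + 1) = ∅) ∧
      ∀ j, ∀ N ⊆ P, (∀ x ∈ N, ∀ y ∈ N, x ≠ y → 2 * s j < dist x y) →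
        (Q j).card * M j ≤ 2 * (P.card - N.card) := by
  set dense : ℕ → Finset α := fun j ↦
    P.filter fun q ↦ M (j + 1) ≤ (P.filter fun x ↦ dist q x ≤ s (j + 1)).card with hdense
  have hnet := fun j ↦ exists_separated_net (dense j) (ρ := 2 * s (j + 1))
    (by linarith [hs (j + 1)])
  choose T hTd hsep hcov using hnet
  refine ⟨fun j ↦ match j with
    | 0 => P.filter fun x ↦ ∃ y ∈ P, y ≠ x ∧ dist x y ≤ s 0
    | j + 1 => T j, ?_, ?_, ?_, ?_, ?_⟩
  · rintro (_ | j)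
    exacts [Finset.filter_subset _ _, (hTd j).trans (Finset.filter_subset _ _)]
  · intro x hx y hy hxy hd
    exact Finset.mem_filter.2 ⟨hx, y, hy, hxy.symm, hd⟩
  · intro j q hq hz
    by_contra! hlt
    obtain ⟨z, hzT, hzd⟩ := hcov j q (Finset.mem_filter.2 ⟨hq, hlt.le⟩)
    exact (hz z hzT).not_ge hzd
  · intro j hj
    refine Finset.eq_empty_of_forall_notMem fun x hx ↦ ?_
    have h1 := (Finset.mem_filter.1 (hTd j hx)).2
    have h2 : ((P.filter fun y ↦ dist x y ≤ s (j + 1)).card : ℝ) ≤ P.card := by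
      exact_mod_cast Finset.card_le_card (Finset.filter_subset _ _)
    linarith
  · rintro (_ | j) N hNP hN
    · rw [hM0, mul_one]
      exact card_le_of_near_neighbour (hs 0) hNP (Finset.filter_subset _ _) hN
        fun x hx ↦ (Finset.mem_filter.1 hx).2
    · exact card_mul_le_of_dense_balls (hM j) hNP hN (hsep j)
        fun q hq ↦ (Finset.mem_filter.1 (hTd j hq)).2

/-- Edges between two consecutive levels of a hierarchy. -/
lemma exists_level_edges {V : Type*} [NormedAddCommGroup V] [InnerProductSpace ℝ V]
    [DecidableEq V] {P Q Q' : Finset V} (hQP : Q ⊆ P) (hQP' : Q' ⊆ P) {a D r M : ℝ}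
    (ha : 0 < a) (hr : 0 ≤ r) (hD : 0 ≤ D) (hrD : r ≤ 4 * D) (hM : 1 ≤ M)
    (hQM : ∀ q ∈ P, (∀ z ∈ Q', 2 * r < dist q z) →
      ((P.filter fun x ↦ dist q x ≤ r).card : ℝ) ≤ M)
    (hfar : P.card * Real.exp (-(a * D ^ 2 / 2)) ≤ Real.exp (-(a * r ^ 2)) / 4) :
    ∃ E : Finset (Sym2 V), (∀ e ∈ E, ¬ e.IsDiag ∧ ∀ v ∈ e, v ∈ P) ∧
      (E.card : ℝ) ≤ Q.card * (2 + 4 * (1 + Real.log M) * Real.exp (a * r ^ 2)) ∧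
      ∀ x ∈ Q, ∀ y ∈ Q, dist x y ≤ r → ShortPath E x y (4 * D) ∨
        ∃ x' ∈ Q', ∃ y' ∈ Q', (dist x x' ≤ 2 * r ∧ ShortPath E x x' (2 * r)) ∧
          dist y y' ≤ 2 * r ∧ ShortPath E y y' (2 * r) := by
  have hlink : ∀ q, ∃ z, (∃ z ∈ Q', dist q z ≤ 2 * r) → z ∈ Q' ∧ dist q z ≤ 2 * r := by
    intro q
    by_cases h : ∃ z ∈ Q', dist q z ≤ 2 * r
    · obtain ⟨z, hz⟩ := h
      exact ⟨z, fun _ ↦ hz⟩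
    · exact ⟨q, fun h' ↦ absurd h' h⟩
  choose f hf using hlink
  set L := Q.filter fun q ↦ (∃ z ∈ Q', dist q z ≤ 2 * r) ∧ q ≠ f q with hL
  set U := (Q ×ˢ Q).filter fun u ↦ (∀ z ∈ Q', 2 * r < dist u.1 z) ∧ dist u.1 u.2 ≤ r with hU
  have hUM : (U.card : ℝ) ≤ Q.card * M := by
    have hsub : U ⊆ (Q.filter fun q ↦ ∀ z ∈ Q', 2 * r < dist q z).biUnion fun q ↦
        (P.filter fun x ↦ dist q x ≤ r).image fun x ↦ (q, x) := by
      rintro ⟨q, x⟩ hu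
      simp only [hU, Finset.mem_filter, Finset.mem_product] at hu
      simp only [Finset.mem_biUnion, Finset.mem_filter, Finset.mem_image]
      exact ⟨q, ⟨hu.1.1, hu.2.1⟩, x, ⟨hQP hu.1.2, hu.2.2⟩, rfl⟩
    have h1 := (Finset.card_le_card hsub).trans Finset.card_biUnion_le
    calc (U.card : ℝ) ≤ ∑ q ∈ Q with (∀ z ∈ Q', 2 * r < dist q z),
          (((P.filter fun x ↦ dist q x ≤ r).image fun x ↦ (q, x)).card : ℝ) := by
            exact_mod_cast h1
      _ ≤ ∑ q ∈ Q with (∀ z ∈ Q', 2 * r < dist q z), M := by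
          refine Finset.sum_le_sum fun q hq ↦ ?_
          rw [Finset.mem_filter] at hq
          refine le_trans ?_ (hQM q (hQP hq.1) hq.2)
          exact_mod_cast Finset.card_image_le
      _ ≤ Q.card * M := by
          rw [Finset.sum_const, nsmul_eq_mul]
          gcongr
          exact Finset.filter_subset _ _
  obtain ⟨E, hE, hEc, hEp⟩ := exists_layer_edges Q U ha hD hrD hM (fun u hu ↦ by
    simp only [hU, Finset.mem_filter, Finset.mem_product] at hu
    exact ⟨hu.1.1, hu.1.2, hu.2.2⟩) hUM (le_trans (by gcongr) hfar)
  refine ⟨L.image (fun q ↦ s(q, f q)) ∪ E, ?_, ?_, ?_⟩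
  · intro e he
    rcases Finset.mem_union.1 he with he | he
    · obtain ⟨q, hq, rfl⟩ := Finset.mem_image.1 he
      rw [Finset.mem_filter] at hq
      simp [hq.2.2, hQP hq.1, hQP' (hf q hq.2.1).1]
    · exact ⟨(hE e he).1, fun v hv ↦ hQP ((hE e he).2 v hv)⟩
  · have h1 : ((L.image (fun q ↦ s(q, f q)) ∪ E).card : ℝ) ≤ Q.card + E.card := by
      exact_mod_cast (Finset.card_union_le _ _).trans (add_le_add_left
        (Finset.card_image_le.trans (Finset.card_le_card (Finset.filter_subset _ _))) _)
    linarith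
  · have hlinked : ∀ q ∈ Q, (∃ z ∈ Q', dist q z ≤ 2 * r) →
        ShortPath (L.image (fun q ↦ s(q, f q)) ∪ E) q (f q) (2 * r) := by
      intro q hq hz
      by_cases hqf : q = f q
      · rw [← hqf]; exact .refl q (by linarith)
      · exact .of_mem (Finset.mem_union_left _ (Finset.mem_image_of_mem _
          (Finset.mem_filter.2 ⟨hq, hz, hqf⟩))) (hf q hz).2
    have hunlinked : ∀ x ∈ Q, ∀ y ∈ Q, dist x y ≤ r → ¬ (∃ z ∈ Q', dist x z ≤ 2 * r) →
        ShortPath (L.image (fun q ↦ s(q, f q)) ∪ E) x y (4 * D) := by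
      intro x hx y hy hxy hz
      push Not at hz
      exact (hEp (x, y) (Finset.mem_filter.2 ⟨Finset.mk_mem_product hx hy, hz, hxy⟩)).mono
        Finset.subset_union_right le_rfl
    intro x hx y hy hxy
    by_cases hxz : ∃ z ∈ Q', dist x z ≤ 2 * r
    · by_cases hyz : ∃ z ∈ Q', dist y z ≤ 2 * r
      · exact .inr ⟨f x, (hf x hxz).1, f y, (hf y hyz).1, ⟨(hf x hxz).2, hlinked x hx hxz⟩,
          (hf y hyz).2, hlinked y hy hyz⟩
      · exact .inl (hunlinked y hy x hx (by rwa [dist_comm]) hyz).symm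
    · exact .inl (hunlinked x hx y hy hxy hxz)

/-- A spanner for the pairs at one distance scale. -/
lemma exists_scale_edges {V : Type*} [NormedAddCommGroup V] [InnerProductSpace ℝ V]
    [DecidableEq V] (P : Finset V) (s M : ℕ → ℝ) (J : ℕ) {a D S : ℝ} (ha : 0 < a) (hD : 0 ≤ D)
    (hs0 : 0 ≤ s 0) (hs : ∀ j, s (j + 1) = 8 * s j) (hM0 : M 0 = 1) (hM : ∀ j, 2 ≤ M (j + 1))
    (hJ : (P.card : ℝ) < M (J + 1)) (hS : ∀ j, M j ≤ P.card → s j ≤ S) (hSD : 8 * S ≤ 4 * D)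
    (hfar : P.card * Real.exp (-(a * D ^ 2 / 2)) ≤ Real.exp (-(a * (8 * S) ^ 2)) / 4) :
    ∃ (E : Finset (Sym2 V)) (c : ℕ → ℝ), (∀ e ∈ E, ¬ e.IsDiag ∧ ∀ v ∈ e, v ∈ P) ∧
      (E.card : ℝ) ≤ ∑ j ∈ Finset.range (J + 1), c j *
        (2 + 4 * (1 + Real.log (M (j + 1))) * Real.exp (a * s (j + 1) ^ 2)) ∧
      (∀ j, ∀ N ⊆ P, (∀ x ∈ N, ∀ y ∈ N, x ≠ y → 2 * s j < dist x y) →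
        c j * M j ≤ 2 * (P.card - N.card)) ∧
      ∀ x ∈ P, ∀ y ∈ P, dist x y ≤ s 0 → ShortPath E x y (4 * D + 5 * S) := by
  have hsnn : ∀ j, 0 ≤ s j := by
    intro j
    induction j with
    | zero => exact hs0
    | succ j ih => rw [hs]; linarith
  obtain ⟨Q, hQP, hQ0, hQcov, hQempty, hQcharge⟩ := exists_hierarchy P s M hsnn hM0 hM
  have hQS : ∀ j, (Q j).Nonempty → s j ≤ S := by
    rintro j ⟨x, hx⟩
    refine hS j ?_
    rcases j with _ | j
    · rw [hM0]
      exact_mod_cast Finset.card_pos.2 ⟨x, hQP 0 hx⟩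
    · by_contra! hlt
      rw [hQempty j hlt] at hx
      exact Finset.notMem_empty x hx
  have hlevel : ∀ j, ∃ E : Finset (Sym2 V), (∀ e ∈ E, ¬ e.IsDiag ∧ ∀ v ∈ e, v ∈ P) ∧
      (E.card : ℝ) ≤ (Q j).card *
        (2 + 4 * (1 + Real.log (M (j + 1))) * Real.exp (a * s (j + 1) ^ 2)) ∧
      ∀ x ∈ Q j, ∀ y ∈ Q j, dist x y ≤ s (j + 1) → ShortPath E x y (4 * D) ∨
        ∃ x' ∈ Q (j + 1), ∃ y' ∈ Q (j + 1),
          (dist x x' ≤ 2 * s (j + 1) ∧ ShortPath E x x' (2 * s (j + 1))) ∧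
          dist y y' ≤ 2 * s (j + 1) ∧ ShortPath E y y' (2 * s (j + 1)) := by
    intro j
    rcases (Q j).eq_empty_or_nonempty with h | h
    · exact ⟨∅, by simp [h]⟩
    · have h1 : s (j + 1) ≤ 8 * S := by rw [hs]; linarith [hQS j h]
      refine exists_level_edges (hQP j) (hQP (j + 1)) ha (hsnn _) hD (h1.trans hSD)
        (by linarith [hM j]) (hQcov j) (hfar.trans ?_)
      have := hsnn (j + 1)
      gcongr
  choose E hE hEc hEp using hlevel
  refine ⟨(Finset.range (J + 1)).biUnion E, fun j ↦ (Q j).card, ?_, ?_, hQcharge, ?_⟩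
  · intro e he
    obtain ⟨j, _, hj⟩ := Finset.mem_biUnion.1 he
    exact hE j e hj
  · calc (((Finset.range (J + 1)).biUnion E).card : ℝ)
        ≤ ∑ j ∈ Finset.range (J + 1), ((E j).card : ℝ) := by
          exact_mod_cast Finset.card_biUnion_le
      _ ≤ _ := Finset.sum_le_sum fun j _ ↦ hEc j
  · have hdesc : ∀ k j, j + k = J + 1 → ∀ x ∈ Q j, ∀ y ∈ Q j, dist x y ≤ s (j + 1) →
        ShortPath ((Finset.range (J + 1)).biUnion E) x y (4 * D + 5 * (S - s j)) := by
      intro k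
      induction k with
      | zero =>
        intro j hj x hx
        rw [← add_zero j, hj, hQempty J hJ] at hx
        exact absurd hx (Finset.notMem_empty x)
      | succ k ih =>
        intro j hj x hx y hy hxy
        have hsub : E j ⊆ (Finset.range (J + 1)).biUnion E :=
          Finset.subset_biUnion_of_mem E (Finset.mem_range.2 (by omega))
        rcases hEp j x hx y hy hxy with h | ⟨x', hx', y', hy', ⟨hdx, hpx⟩, hdy, hpy⟩
        · exact h.mono hsub (by linarith [hQS j ⟨x, hx⟩])
        · have hd : dist x' y' ≤ s (j + 1 + 1) := by
            rw [hs (j + 1)]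
            have h1 := dist_triangle4 x' x y y'
            rw [dist_comm x' x] at h1
            linarith [hsnn (j + 1)]
          have h2 := ih (j + 1) (by omega) x' hx' y' hy' hd
          refine (((hpx.mono hsub le_rfl).trans h2).trans
            (hpy.symm.mono hsub le_rfl)).mono subset_rfl ?_
          have := hsnn j
          linarith [hs j]
    intro x hx y hy hxy
    have hS0 : s 0 ≤ S := hS 0 (by
      rw [hM0]
      exact_mod_cast Finset.card_pos.2 ⟨x, hx⟩)
    by_cases hne : x = y
    · rw [hne]; exact .refl y (by linarith)
    · refine (hdesc (J + 1) 0 (by omega) x (hQ0 x hx y hy hne hxy) y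
        (hQ0 y hy x hx (Ne.symm hne) (by rwa [dist_comm])) ?_).mono subset_rfl (by linarith)
      rw [hs 0]; linarith

/-- Decreasing nested nets at geometrically increasing scales. -/
lemma exists_nested_nets {α : Type*} [MetricSpace α] [DecidableEq α] (K : Finset α) :
    ∃ (ρ : ℝ) (N : ℕ → Finset α), 0 < ρ ∧ N 0 = K ∧ Antitone N ∧
      (∀ x ∈ K, ∀ y ∈ K, dist x y ≤ 8 * ρ → x = y) ∧
      (∀ i, ∀ x ∈ N i, ∀ y ∈ N i, x ≠ y → 8 ^ i * ρ < dist x y) ∧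
      ∀ i, ∀ x ∈ K, ∃ y ∈ N i, dist x y ≤ 2 * (8 ^ i * ρ) := by
  obtain ⟨ρ, hρ, hmin⟩ : ∃ ρ : ℝ, 0 < ρ ∧ ∀ x ∈ K, ∀ y ∈ K, dist x y ≤ 8 * ρ → x = y := by
    rcases (K.offDiag).eq_empty_or_nonempty with h | h
    · refine ⟨1, one_pos, fun x hx y hy _ ↦ ?_⟩
      by_contra hxy
      exact (Finset.eq_empty_iff_forall_notMem.1 h) (x, y) (Finset.mem_offDiag.2 ⟨hx, hy, hxy⟩)
    · obtain ⟨p, hp, hmin⟩ := Finset.exists_min_image K.offDiag (fun p ↦ dist p.1 p.2) h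
      have hpos := dist_pos.2 (Finset.mem_offDiag.1 hp).2.2
      refine ⟨dist p.1 p.2 / 16, by positivity, fun x hx y hy hd ↦ ?_⟩
      by_contra hxy
      have := hmin (x, y) (Finset.mem_offDiag.2 ⟨hx, hy, hxy⟩)
      dsimp only at this
      linarith
  have hnet := fun (S : Finset α) (i : ℕ) ↦ exists_separated_net S (ρ := 8 ^ i * ρ) (by positivity)
  choose T hTS hsep hcov using hnet
  set N : ℕ → Finset α := fun i ↦ Nat.rec K (fun i S ↦ T S (i + 1)) i with hN
  have hNs : ∀ i, N (i + 1) = T (N i) (i + 1) := fun _ ↦ rfl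
  refine ⟨ρ, N, hρ, rfl, antitone_nat_of_succ_le fun i ↦ ?_, hmin, ?_, ?_⟩
  · rw [hNs]; exact hTS _ _
  · rintro (_ | i) x hx y hy hxy
    · by_contra! hle
      exact hxy (hmin x hx y hy (by linarith [hle.trans_eq (by ring : (8 : ℝ) ^ 0 * ρ = ρ)]))
    · rw [hNs] at hx hy
      exact hsep _ _ x hx y hy hxy
  · intro i
    induction i with
    | zero => exact fun x hx ↦ ⟨x, hx, by rw [dist_self]; positivity⟩
    | succ i ih =>
      intro x hx
      obtain ⟨y, hy, hxy⟩ := ih x hx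
      obtain ⟨z, hz, hyz⟩ := hcov (N i) (i + 1) y hy
      refine ⟨z, by rw [hNs]; exact hz, (dist_triangle x y z).trans ?_⟩
      rw [pow_succ] at hyz ⊢
      have : 0 < 8 ^ i * ρ := by positivity
      linarith

/-- Telescoping with a lag. -/
lemma sum_sub_lag_le (f : ℕ → ℝ) (hf : Antitone f) (h0 : ∀ i, 0 ≤ f i) (I l : ℕ) :
    ∑ i ∈ Finset.range I, (f i - f (i + l)) ≤ l * f 0 := by
  induction l with
  | zero => simp
  | succ l ih =>
    have h1 : ∑ i ∈ Finset.range I, (f (i + l) - f (i + 1 + l)) = f (0 + l) - f (I + l) :=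
      Finset.sum_range_sub' (fun i ↦ f (i + l)) I
    have h2 : ∑ i ∈ Finset.range I, (f i - f (i + (l + 1))) =
        ∑ i ∈ Finset.range I, (f i - f (i + l)) +
          ∑ i ∈ Finset.range I, (f (i + l) - f (i + 1 + l)) := by
      rw [← Finset.sum_add_distrib]
      refine Finset.sum_congr rfl fun i _ ↦ ?_
      rw [show i + (l + 1) = i + 1 + l by ring]; ring
    rw [h2, h1]
    push_cast
    linarith [hf (Nat.zero_le (0 + l)), h0 (I + l)]

/-- Density threshold at level `j` of the hierarchy. -/
noncomputable def levelThreshold (Λ : ℝ) : ℕ → ℝ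
  | 0 => 1
  | j + 1 => Real.exp ((1 + Λ) * 64 ^ (j + 4))

/-- Number of edges per centre at level `j` of the hierarchy. -/
noncomputable def levelCost (Λ : ℝ) (j : ℕ) : ℝ :=
  2 + 4 * (1 + (1 + Λ) * 64 ^ (j + 4)) * Real.exp (Λ * 64 ^ j / 64)

lemma levelThreshold_pos (Λ : ℝ) (j : ℕ) : 0 < levelThreshold Λ j := by
  cases j
  exacts [one_pos, Real.exp_pos _]

lemma levelCost_nonneg {Λ : ℝ} (hΛ : 0 ≤ Λ) (j : ℕ) : 0 ≤ levelCost Λ j := by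
  unfold levelCost; positivity

lemma levelCost_zero_le {Λ : ℝ} (hΛ : 0 ≤ Λ) :
    levelCost Λ 0 ≤ (6 + 16 * 64 ^ 4) * Real.exp Λ := by
  have h1 : 1 + Λ ≤ 4 * Real.exp (Λ / 4) := by linarith [Real.add_one_le_exp (Λ / 4)]
  have h2 : Real.exp (Λ / 4) * Real.exp (Λ / 64) ≤ Real.exp Λ := by
    rw [← Real.exp_add]; gcongr; linarith
  have h3 : Real.exp (Λ / 64) ≤ Real.exp Λ := by gcongr; linarith
  have h4 : 1 ≤ Real.exp Λ := Real.one_le_exp hΛ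
  have h5 : (1 + Λ) * Real.exp (Λ / 64) ≤ 4 * Real.exp Λ :=
    (mul_le_mul_of_nonneg_right h1 (Real.exp_pos _).le).trans (by linarith)
  simp only [levelCost, zero_add, pow_zero, mul_one]
  linarith

lemma levelCost_succ_le {Λ : ℝ} (hΛ : 0 ≤ Λ) (j : ℕ) :
    2 * ((j + 1 : ℕ) + 4) * levelCost Λ (j + 1) ≤
      50 * 64 ^ 5 * (1 / 2) ^ j * levelThreshold Λ (j + 1) := by
  set Y : ℝ := (1 + Λ) * 64 ^ j with hY
  have hpow : (1 : ℝ) ≤ 64 ^ j := one_le_pow₀ (by norm_num)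
  have hjY : (j : ℝ) ≤ Y := by
    have h1 : (j : ℝ) ≤ 64 ^ j := by
      exact_mod_cast (Nat.lt_pow_self (by norm_num : 1 < 64)).le
    nlinarith
  have hY0 : 0 ≤ Y := by positivity
  have hexp := Real.add_one_le_exp Y
  have h1 : 1 ≤ Real.exp Y := Real.one_le_exp hY0
  have hA : 2 * (((j + 1 : ℕ) : ℝ) + 4) ≤ 10 * Real.exp Y := by push_cast; linarith
  have hB : levelCost Λ (j + 1) ≤ 5 * 64 ^ 5 * (Real.exp Y * Real.exp Y) := by
    have h2 : (1 + Λ) * 64 ^ (j + 1 + 4) = 64 ^ 5 * Y := by rw [hY]; ring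
    have h3 : Real.exp (Λ * 64 ^ (j + 1) / 64) ≤ Real.exp Y := by
      gcongr
      rw [pow_succ, hY]; linarith
    have h4 : (1 + 64 ^ 5 * Y) * Real.exp (Λ * 64 ^ (j + 1) / 64) ≤
        (64 ^ 5 * Real.exp Y) * Real.exp Y := by
      gcongr; linarith
    have h5 : 1 ≤ Real.exp Y * Real.exp Y := by nlinarith
    rw [levelCost, h2]
    linarith
  have hC : levelThreshold Λ (j + 1) = Real.exp (64 ^ 4 * Y) := by
    rw [levelThreshold, hY]; ring_nf
  have hD : Real.exp Y * Real.exp Y * Real.exp Y * (2 : ℝ) ^ j ≤ Real.exp (64 ^ 4 * Y) := by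
    have h2 : (2 : ℝ) ^ j ≤ Real.exp Y := by
      calc (2 : ℝ) ^ j ≤ Real.exp 1 ^ j := by
            gcongr; linarith [Real.add_one_le_exp (1 : ℝ)]
        _ = Real.exp j := by rw [← Real.exp_nat_mul, mul_one]
        _ ≤ _ := by gcongr
    calc _ ≤ Real.exp Y * Real.exp Y * Real.exp Y * Real.exp Y := by gcongr
      _ = Real.exp (4 * Y) := by rw [← Real.exp_add, ← Real.exp_add, ← Real.exp_add]; ring_nf
      _ ≤ _ := by gcongr; linarith
  have hinv : ((1 : ℝ) / 2) ^ j * 2 ^ j = 1 := by rw [← mul_pow]; norm_num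
  rw [hC]
  calc _ ≤ (10 * Real.exp Y) * (5 * 64 ^ 5 * (Real.exp Y * Real.exp Y)) :=
        mul_le_mul hA hB (levelCost_nonneg hΛ _) (by positivity)
    _ = 50 * 64 ^ 5 * (1 / 2) ^ j * (Real.exp Y * Real.exp Y * Real.exp Y * 2 ^ j) := by
        linear_combination (-(50 * 64 ^ 5 * Real.exp Y * Real.exp Y * Real.exp Y)) * hinv
    _ ≤ _ := by gcongr

lemma exists_sum_levelCost_le : ∃ C : ℝ, 0 < C ∧ ∀ Λ : ℝ, 0 ≤ Λ → ∀ J : ℕ,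
    ∑ j ∈ Finset.range (J + 1), 2 * ((j : ℝ) + 4) * levelCost Λ j / levelThreshold Λ j ≤
      C * Real.exp Λ := by
  refine ⟨8 * (6 + 16 * 64 ^ 4) + 100 * 64 ^ 5, by positivity, fun Λ hΛ J ↦ ?_⟩
  have h1 : 1 ≤ Real.exp Λ := Real.one_le_exp hΛ
  rw [Finset.sum_range_succ']
  have h2 : ∑ j ∈ Finset.range J, 2 * (((j + 1 : ℕ) : ℝ) + 4) * levelCost Λ (j + 1) /
      levelThreshold Λ (j + 1) ≤ 50 * 64 ^ 5 * 2 := by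
    calc _ ≤ ∑ j ∈ Finset.range J, 50 * 64 ^ 5 * ((1 : ℝ) / 2) ^ j :=
          Finset.sum_le_sum fun j _ ↦ by
            rw [div_le_iff₀ (levelThreshold_pos _ _)]
            exact levelCost_succ_le hΛ j
      _ ≤ _ := by
          rw [← Finset.mul_sum]
          gcongr
          exact sum_geometric_two_le J
  have h3 := levelCost_zero_le hΛ
  have h4 : levelThreshold Λ 0 = 1 := rfl
  rw [h4, Nat.cast_zero]
  linarith

/-- The scale spanner with the parameters used for `t`-spanners. -/
lemma exists_scale_spanner {V : Type*} [NormedAddCommGroup V] [InnerProductSpace ℝ V]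
    [DecidableEq V] (P : Finset V) {n t : ℕ} (hn : 2 ≤ n) (ht : 1 ≤ t) (hP : P.card ≤ n) {r : ℝ}
    (hr : 0 < r) :
    ∃ (E : Finset (Sym2 V)) (c : ℕ → ℝ), (∀ e ∈ E, ¬ e.IsDiag ∧ ∀ v ∈ e, v ∈ P) ∧
      (E.card : ℝ) ≤ ∑ j ∈ Finset.range (n + 1), c j * levelCost (Real.log n / t ^ 2) j ∧
      (∀ j, ∀ N ⊆ P, (∀ x ∈ N, ∀ y ∈ N, x ≠ y → 2 * (8 ^ (j + 3) * r) < dist x y) →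
        c j * levelThreshold (Real.log n / t ^ 2) j ≤ 2 * (P.card - N.card)) ∧
      ∀ x ∈ P, ∀ y ∈ P, dist x y ≤ 512 * r → ShortPath E x y (8 ^ 7 * t * r) := by
  set L := Real.log n with hL
  set Λ := L / t ^ 2 with hΛ
  have ht' : (1 : ℝ) ≤ t := by exact_mod_cast ht
  have hn' : (2 : ℝ) ≤ n := by exact_mod_cast hn
  have hL2 : Real.log 2 ≤ L := Real.log_le_log (by norm_num) hn'
  have hLpos : 0 < L := (Real.log_pos (by norm_num)).trans_le hL2
  have hexpL : Real.exp L = n := Real.exp_log (by linarith)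
  have hΛpos : 0 < Λ := by positivity
  have hLΛ : L = Λ * t ^ 2 := by rw [hΛ]; field_simp
  have hP' : (P.card : ℝ) ≤ n := by exact_mod_cast hP
  have htr : r ≤ t * r := le_mul_of_one_le_left hr.le ht'
  obtain ⟨E, c, hE, hEc, hch, hpath⟩ := exists_scale_edges P (fun j ↦ 8 ^ (j + 3) * r)
    (levelThreshold Λ) n (a := Λ / (64 ^ 5 * r ^ 2)) (D := 8 ^ 6 * t * r) (S := 512 * t * r)
    (by positivity) (by positivity) (by positivity) (fun j ↦ by ring) rfl (fun j ↦ by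
      have h1 : (1 : ℝ) ≤ 64 ^ (j + 4) := one_le_pow₀ (by norm_num)
      have h2 := Real.add_one_le_exp ((1 + Λ) * 64 ^ (j + 4))
      rw [levelThreshold]
      nlinarith) (by
      have h1 : (n : ℝ) ≤ 64 ^ (n + 4) := by
        exact_mod_cast (Nat.lt_pow_self (by norm_num : 1 < 64)).le.trans
          (Nat.pow_le_pow_right (by norm_num) (by omega : n ≤ n + 4))
      have h2 := Real.add_one_le_exp ((1 + Λ) * 64 ^ (n + 4))
      rw [levelThreshold]
      nlinarith) (by
      rintro (_ | j) hj
      · norm_num1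
        linarith
      · have h1 : (1 + Λ) * 64 ^ (j + 4) ≤ L := by
          rw [← Real.exp_le_exp, hexpL]
          exact hj.trans hP'
        have h2 : (64 : ℝ) ^ (j + 4) ≤ t ^ 2 := by
          have : (1 + Λ) * 64 ^ (j + 4) ≤ (1 + Λ) * t ^ 2 := by nlinarith
          exact le_of_mul_le_mul_left this (by positivity)
        have h3 : (8 : ℝ) ^ (j + 4) ≤ t := by
          refine le_of_sq_le_sq ?_ (by positivity)
          rw [← pow_mul, mul_comm, pow_mul]
          norm_num1
          exact h2
        have h4 := mul_le_mul_of_nonneg_right h3 hr.le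
        have h5 : (0 : ℝ) ≤ t * r := by positivity
        show (8 : ℝ) ^ (j + 4) * r ≤ 512 * t * r
        linarith) (by nlinarith) (by
      have h1 : Λ / (64 ^ 5 * r ^ 2) * (8 ^ 6 * t * r) ^ 2 / 2 = 32 * L := by
        rw [hLΛ]; field_simp; ring
      have h2 : Λ / (64 ^ 5 * r ^ 2) * (8 * (512 * t * r)) ^ 2 = L / 64 := by
        rw [hLΛ]; field_simp; ring
      rw [h1, h2]
      have h3 : (4 : ℝ) = Real.exp (2 * Real.log 2) := by
        rw [two_mul, Real.exp_add, Real.exp_log (by norm_num)]; norm_num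
      have h4 : Real.exp L * Real.exp (-(32 * L)) * 4 ≤ Real.exp (-(L / 64)) := by
        rw [h3, ← Real.exp_add, ← Real.exp_add]
        gcongr
        linarith
      rw [hexpL] at h4
      have h5 := mul_le_mul_of_nonneg_right hP' (Real.exp_pos (-(32 * L))).le
      linarith)
  refine ⟨E, c, hE, hEc.trans_eq (Finset.sum_congr rfl fun j _ ↦ ?_), hch, ?_⟩
  · have h1 : Λ / (64 ^ 5 * r ^ 2) * (8 ^ (j + 1 + 3) * r) ^ 2 = Λ * 64 ^ j / 64 := by
      have : ((8 : ℝ) ^ (j + 1 + 3) * r) ^ 2 = 64 ^ j * (64 ^ 4 * r ^ 2) := by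
        rw [mul_pow, ← pow_mul, mul_comm (j + 1 + 3), pow_mul, add_assoc, pow_add]; norm_num; ring
      rw [this]; field_simp
    simp only [h1, levelCost, levelThreshold, Real.log_exp]
  · intro x hx y hy hxy
    refine (hpath x hx y hy (by norm_num1; exact hxy)).mono subset_rfl ?_
    have : 0 ≤ t * r := by positivity
    linarith

/-- Every finite Euclidean metric on `n` points has an `O(t)`-spanner with `O(n ^ (1 + 1 / t ^ 2))`
edges. -/
lemma exists_euclidean_spanner : ∃ C : ℝ, 0 < C ∧
    ∀ (V : Type*) [NormedAddCommGroup V] [InnerProductSpace ℝ V] [DecidableEq V]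
      (K : Finset V) (t : ℕ), 2 ≤ K.card → 1 ≤ t → ∃ E : Finset (Sym2 V),
        (∀ e ∈ E, ¬ e.IsDiag ∧ ∀ v ∈ e, v ∈ K) ∧
        (E.card : ℝ) ≤ C * (K.card : ℝ) ^ ((1 : ℝ) + 1 / (t : ℝ) ^ 2) ∧
        ∀ x ∈ K, ∀ y ∈ K, ShortPath E x y (C * t * dist x y) := by
  obtain ⟨C₀, hC₀, hsum⟩ := exists_sum_levelCost_le
  refine ⟨C₀ + 8 ^ 7, by positivity, fun V _ _ _ K t hK ht ↦ ?_⟩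
  obtain ⟨ρ, N, hρ, hN0, hanti, hmin, hsep, hcov⟩ := exists_nested_nets K
  have hNK : ∀ i, N i ⊆ K := fun i ↦ hN0 ▸ hanti (Nat.zero_le i)
  have hscale := fun i ↦ exists_scale_spanner (N i) hK ht (Finset.card_le_card (hNK i))
    (r := 8 ^ i * ρ) (by positivity)
  choose E c hE hEc hch hpath using hscale
  obtain ⟨R, hR⟩ := Metric.isBounded_iff.1 K.finite_toSet.isBounded
  obtain ⟨I, hI⟩ := pow_unbounded_of_one_lt (R / ρ) (by norm_num : (1 : ℝ) < 8)
  rw [div_lt_iff₀ hρ] at hI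
  set n := K.card with hn
  set Λ := Real.log n / t ^ 2 with hΛ
  have hn' : (2 : ℝ) ≤ n := by exact_mod_cast hK
  have ht' : (1 : ℝ) ≤ t := by exact_mod_cast ht
  have hΛ0 : 0 ≤ Λ := div_nonneg (Real.log_nonneg (by linarith)) (by positivity)
  refine ⟨(Finset.range I).biUnion E, ?_, ?_, ?_⟩
  · intro e he
    obtain ⟨i, _, hi⟩ := Finset.mem_biUnion.1 he
    exact ⟨(hE i e hi).1, fun v hv ↦ hNK i ((hE i e hi).2 v hv)⟩
  · have hlevel : ∀ j, ∑ i ∈ Finset.range I, c i j * levelCost Λ j ≤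
        2 * ((j : ℝ) + 4) * levelCost Λ j / levelThreshold Λ j * n := by
      intro j
      have h1 : ∑ i ∈ Finset.range I, c i j * levelThreshold Λ j ≤ 2 * (((j : ℝ) + 4) * n) := by
        calc _ ≤ ∑ i ∈ Finset.range I, 2 * (((N i).card : ℝ) - (N (i + (j + 4))).card) := by
              refine Finset.sum_le_sum fun i _ ↦
                hch i j _ (hanti (Nat.le_add_right _ _)) fun x hx y hy hxy ↦ ?_
              refine lt_of_le_of_lt ?_ (hsep _ x hx y hy hxy)
              have : (8 : ℝ) ^ (i + (j + 4)) * ρ = 8 * (8 ^ (j + 3) * (8 ^ i * ρ)) := by ring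
              rw [this]
              gcongr
              norm_num
          _ ≤ _ := by
              rw [← Finset.mul_sum]
              have := sum_sub_lag_le (fun i ↦ ((N i).card : ℝ))
                (fun i j hij ↦ Nat.cast_le.2 (Finset.card_le_card (hanti hij)))
                (fun i ↦ Nat.cast_nonneg _) I (j + 4)
              rw [hN0] at this
              push_cast at this
              linarith
      rw [← Finset.sum_mul] at h1 ⊢
      rw [div_mul_eq_mul_div, le_div_iff₀ (levelThreshold_pos _ _)]
      have := mul_le_mul_of_nonneg_right h1 (levelCost_nonneg hΛ0 j)
      linarith
    calc (((Finset.range I).biUnion E).card : ℝ)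
        ≤ ∑ i ∈ Finset.range I, ((E i).card : ℝ) := by exact_mod_cast Finset.card_biUnion_le
      _ ≤ ∑ i ∈ Finset.range I, ∑ j ∈ Finset.range (n + 1), c i j * levelCost Λ j :=
          Finset.sum_le_sum fun i _ ↦ hEc i
      _ = ∑ j ∈ Finset.range (n + 1), ∑ i ∈ Finset.range I, c i j * levelCost Λ j :=
          Finset.sum_comm
      _ ≤ ∑ j ∈ Finset.range (n + 1),
          2 * ((j : ℝ) + 4) * levelCost Λ j / levelThreshold Λ j * n :=
          Finset.sum_le_sum fun j _ ↦ hlevel j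
      _ ≤ C₀ * Real.exp Λ * n := by
          rw [← Finset.sum_mul]
          gcongr
          exact hsum Λ hΛ0 n
      _ = C₀ * (n : ℝ) ^ ((1 : ℝ) + 1 / (t : ℝ) ^ 2) := by
          rw [Real.rpow_add (by linarith), Real.rpow_one, Real.rpow_def_of_pos (by linarith), hΛ,
            mul_one_div]
          ring
      _ ≤ _ := by
          gcongr
          linarith [show (0 : ℝ) < 8 ^ 7 by positivity]
  · have key : ∀ i ≤ I, ∀ x ∈ K, ∀ y ∈ K, dist x y ≤ 8 * (8 ^ i * ρ) →
        ShortPath ((Finset.range I).biUnion E) x y ((C₀ + 8 ^ 7) * t * dist x y) := by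
      intro i
      induction i with
      | zero =>
        intro _ x hx y hy hxy
        rw [hmin x hx y hy (by simpa using hxy)]
        exact .refl y (by positivity)
      | succ i ih =>
        intro hi x hx y hy hxy
        by_cases hsmall : dist x y ≤ 8 * (8 ^ i * ρ)
        · exact ih (by omega) x hx y hy hsmall
        push Not at hsmall
        have hr : 0 < 8 ^ i * ρ := by positivity
        rw [pow_succ] at hxy
        obtain ⟨x', hx', hxx⟩ := hcov i x hx
        obtain ⟨y', hy', hyy⟩ := hcov i y hy
        have hd : dist x' y' ≤ 512 * (8 ^ i * ρ) := by
          have := dist_triangle4 x' x y y'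
          rw [dist_comm x' x] at this
          linarith
        have h1 := ih (by omega) x hx x' (hNK i hx') (by linarith)
        have h2 := ih (by omega) y hy y' (hNK i hy') (by linarith)
        have h3 := (hpath i x' hx' y' hy' hd).mono
          (Finset.subset_biUnion_of_mem E (Finset.mem_range.2 (show i < I by omega))) le_rfl
        refine ((h1.trans h3).trans h2.symm).mono subset_rfl ?_
        have hCt : 0 < (C₀ + 8 ^ 7) * t := by positivity
        have h4 := mul_le_mul_of_nonneg_left hxx hCt.le
        have h5 := mul_le_mul_of_nonneg_left hyy hCt.le
        have h6 := mul_le_mul_of_nonneg_left hsmall.le hCt.le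
        have h7 : 0 < C₀ * t * (8 ^ i * ρ) := by positivity
        have h8 : 0 < t * (8 ^ i * ρ) := by positivity
        linarith
    exact fun x hx y hy ↦ key I le_rfl x hx y hy (by
      have := hR hx hy
      linarith [dist_nonneg (x := x) (y := y)])

lemma mem_of_edges_mem {α : Type*} {X : Finset α} {E : Finset (Sym2 α)}
    (hE : ∀ e ∈ E, ∀ a ∈ e, a ∈ X) {m : ℕ} {x : Fin (m + 1) → α} (h0 : x 0 ∈ X)
    (hx : ∀ i : Fin m, s(x i.castSucc, x i.succ) ∈ E) (i : Fin (m + 1)) : x i ∈ X := by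
  refine Fin.cases h0 (fun j ↦ ?_) i
  exact hE _ (hx j) _ (Sym2.mem_mk_right _ _)

/-- Joining every other point to its nearest terminal turns a spanner on the terminals into a
terminal spanner. -/
lemma exists_terminal_edges {α : Type*} [MetricSpace α] [DecidableEq α] {X K : Finset α}
    (hKX : K ⊆ X) (hK : K.Nonempty) {E : Finset (Sym2 α)} {A : ℝ} (hA : 0 ≤ A)
    (hE : ∀ e ∈ E, ¬ e.IsDiag ∧ ∀ v ∈ e, v ∈ K)
    (hpath : ∀ x ∈ K, ∀ y ∈ K, ShortPath E x y (A * dist x y)) :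
    ∃ E' : Finset (Sym2 α), (∀ e ∈ E', ¬ e.IsDiag ∧ ∀ v ∈ e, v ∈ X) ∧
      E'.card ≤ E.card + X.card ∧
      ∀ v ∈ K, ∀ u ∈ X, ShortPath E' v u ((2 * A + 1) * dist v u) := by
  have hnear := fun u ↦ Finset.exists_min_image K (dist u) hK
  choose f hfK hf using hnear
  refine ⟨E ∪ (X \ K).image fun u ↦ s(u, f u), ?_, ?_, ?_⟩
  · intro e he
    rcases Finset.mem_union.1 he with he | he
    · exact ⟨(hE e he).1, fun v hv ↦ hKX ((hE e he).2 v hv)⟩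
    · obtain ⟨u, hu, rfl⟩ := Finset.mem_image.1 he
      rw [Finset.mem_sdiff] at hu
      have : u ≠ f u := fun h ↦ hu.2 (h ▸ hfK u)
      simp [this, hu.1, hKX (hfK u)]
  · exact (Finset.card_union_le _ _).trans (add_le_add_right
      (Finset.card_image_le.trans (Finset.card_le_card Finset.sdiff_subset)) _)
  · intro v hv u hu
    by_cases huK : u ∈ K
    · refine (hpath v hv u huK).mono Finset.subset_union_left ?_
      have := mul_nonneg hA (dist_nonneg (x := v) (y := u))
      linarith [dist_nonneg (x := v) (y := u)]
    · have h1 := (hpath v hv (f u) (hfK u)).mono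
        (Finset.subset_union_left (s₂ := (X \ K).image fun u ↦ s(u, f u))) le_rfl
      have h2 : ShortPath (E ∪ (X \ K).image fun u ↦ s(u, f u)) u (f u) (dist u (f u)) :=
        .of_mem (Finset.mem_union_right _ (Finset.mem_image_of_mem _
          (Finset.mem_sdiff.2 ⟨hu, huK⟩))) le_rfl
      refine (h1.trans h2.symm).mono subset_rfl ?_
      have h3 := hf u v hv
      rw [dist_comm u v] at h3
      have h4 : dist v (f u) ≤ 2 * dist v u := by linarith [dist_triangle v u (f u)]
      have h5 := mul_le_mul_of_nonneg_left h4 hA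
      linarith

/-- Every finite subset `X` of a real inner product space, with `k ≥ 2` terminals
`K ⊆ X`, admits an `O(t)`-terminal metric spanner with at most
`C·k^{1+1/t²} + |X|` edges. -/
theorem terminal_euclidean_spanner :
    ∃ C : ℝ, 0 < C ∧
      ∀ (V : Type) [NormedAddCommGroup V] [InnerProductSpace ℝ V]
        (X K : Finset V) (t : ℕ), K ⊆ X → 2 ≤ K.card → 1 ≤ t →
        ∃ E : Finset (Sym2 V),
          (∀ e ∈ E, ¬ e.IsDiag ∧ ∀ a ∈ e, a ∈ X) ∧
          (E.card : ℝ) ≤ C * (K.card : ℝ) ^ ((1 : ℝ) + 1 / (t : ℝ) ^ 2) + X.card ∧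
          ∀ v ∈ K, ∀ u ∈ X,
            ∃ (m : ℕ) (x : Fin (m + 1) → V),
              (∀ i, x i ∈ X) ∧ x 0 = v ∧ x (Fin.last m) = u ∧
              (∀ i : Fin m, s(x i.castSucc, x i.succ) ∈ E) ∧
              (∑ i : Fin m, ‖x i.castSucc - x i.succ‖) ≤ C * (t : ℝ) * ‖v - u‖ := by
  obtain ⟨C, hC, hspan⟩ := exists_euclidean_spanner.{0}
  refine ⟨2 * C + 1, by positivity, fun V _ _ X K t hKX hK ht ↦ ?_⟩
  classical
  obtain ⟨E, hE, hEc, hEp⟩ := hspan V K t hK ht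
  have ht' : (1 : ℝ) ≤ t := by exact_mod_cast ht
  obtain ⟨E', hE', hEc', hEp'⟩ := exists_terminal_edges hKX (Finset.card_pos.1 (by omega))
    (by positivity) hE hEp
  refine ⟨E', hE', ?_, fun v hv u hu ↦ ?_⟩
  · have h1 : (E'.card : ℝ) ≤ E.card + X.card := by exact_mod_cast hEc'
    have h2 : 0 ≤ (K.card : ℝ) ^ ((1 : ℝ) + 1 / (t : ℝ) ^ 2) := by positivity
    have h3 := mul_nonneg hC.le h2
    linarith
  · obtain ⟨m, x, h0, hm, hx, hlen⟩ := (hEp' v hv u hu).exists_fin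
    refine ⟨m, x, mem_of_edges_mem (fun e he ↦ (hE' e he).2) (h0 ▸ hKX hv) hx, h0, hm, hx, ?_⟩
    simp only [← dist_eq_norm]
    refine hlen.trans ?_
    gcongr
    linarith
end
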